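/- arXiv:0704.2386 — 5 statements merged into one kernel-verified Lean document; each statement's English description precedes it below -/
import Mathlib

section
/- For every bounded pushdown gambler G = (Q, Σ, Γ, δ, β, q₀, z₀, c) there exists a bounded pushdown gambler G′ = (Q′, Σ, Γ′, δ′, β′, q₀′, z₀′, 1), performing at most one λ-transition per input symbol, such that d_G(w) = d_{G′}(w) for all w ∈ Σ*. -/
/-! ### Strings, sequences, gales -/

/-- The length-`n` prefix `S[0..n-1]` of an infinite sequence `S`. -/
def strPrefix {α : Type} (S : ℕ → α) (n : ℕ) : List α := (List.range n).map S

/-- `d` is an `s`-gale over the alphabet `α`: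
it is nonnegative and satisfies `d(w) = |Σ|^{-s} * Σ_{a ∈ Σ} d(wa)`. -/
def IsSGale {α : Type} [Fintype α] (s : ℝ) (d : List α → ℝ) : Prop :=
  (∀ w, 0 ≤ d w) ∧
    ∀ w : List α, d w = (Fintype.card α : ℝ) ^ (-s) * ∑ a : α, d (w ++ [a])

/-- `d` succeeds on the sequence `S`, i.e. `limsup_n d(S[0..n-1]) = ∞`. -/
def succeedsOn {α : Type} (d : List α → ℝ) (S : ℕ → α) : Prop :=
  ∀ C : ℝ, ∃ n : ℕ, C < d (strPrefix S n)

/-! ### Bounded pushdown machinery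

Configurations are pairs (state, stack content), the stack written top-first.
`none` as input symbol denotes a `λ`-transition. -/

/-- One `λ`-transition step on a configuration. -/
def lamStep {α Q Γ : Type} (δ : Q → Option α → Γ → Option (Q × List Γ)) :
    Q × List Γ → Option (Q × List Γ)
  | (_, []) => none
  | (q, a :: v) => (δ q none a).map fun p => (p.1, p.2 ++ v)

/-- `n` consecutive `λ`-transition steps (undefined if any step is undefined). -/
def lamIter {α Q Γ : Type} (δ : Q → Option α → Γ → Option (Q × List Γ)) :
    ℕ → Q × List Γ → Option (Q × List Γ)
  | 0, cfg => some cfg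
  | n + 1, cfg => (lamStep δ cfg).bind (lamIter δ n)

/-- Apply `λ`-transitions as long as possible, but at most `n` times. -/
def lamStar {α Q Γ : Type} (δ : Q → Option α → Γ → Option (Q × List Γ)) :
    ℕ → Q × List Γ → Q × List Γ
  | 0, cfg => cfg
  | n + 1, cfg =>
    match lamStep δ cfg with
    | none => cfg
    | some cfg' => lamStar δ n cfg'

/-- Process one input symbol `b`: first execute the (at most `c`) available
`λ`-transitions, then the transition reading `b`. -/
def symStep {α Q Γ : Type} (δ : Q → Option α → Γ → Option (Q × List Γ)) (c : ℕ)
    (b : α) (cfg : Q × List Γ) : Option (Q × List Γ) :=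
  match lamStar δ c cfg with
  | (_, []) => none
  | (q, a :: v) => (δ q (some b) a).map fun p => (p.1, p.2 ++ v)

/-- The extended transition function: the configuration reached from `cfg`
after processing the input string `w`. -/
def runFrom {α Q Γ : Type} (δ : Q → Option α → Γ → Option (Q × List Γ)) (c : ℕ)
    (cfg : Q × List Γ) (w : List α) : Option (Q × List Γ) :=
  w.foldl (fun o b => o.bind (symStep δ c b)) (some cfg)

/-! ### Bounded pushdown gamblers -/

/-- A bounded pushdown gambler (BPDG) over the input alphabet `α`. -/
structure BPDG (α : Type) [Fintype α] where
  /-- finite set of states -/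
  Q : Type
  /-- finite stack alphabet -/
  Γ : Type
  fintypeQ : Fintype Q
  fintypeΓ : Fintype Γ
  /-- partial transition function; `none` as second argument is a `λ`-transition -/
  δ : Q → Option α → Γ → Option (Q × List Γ)
  /-- betting function: a rational-valued probability measure on `α` for each
  (state, top stack symbol) -/
  β : Q → Γ → α → ℚ
  q0 : Q
  z0 : Γ
  /-- bound on the number of `λ`-transitions per input symbol -/
  c : ℕ
  β_nonneg : ∀ q a b, 0 ≤ β q a b
  β_sum : ∀ q a, ∑ b : α, β q a b = 1
  /-- determinism: a pair (state, top symbol) admits a `λ`-transition or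
  input transitions, but not both -/
  det : ∀ q a, δ q none a = none ∨ ∀ b : α, δ q (some b) a = none
  /-- the bottom symbol `z0` is never removed from the bottom of the stack -/
  bottom : ∀ q (b : Option α), δ q b z0 = none ∨
    ∃ q' v, δ q b z0 = some (q', v ++ [z0])
  /-- no sequence of more than `c` consecutive `λ`-transitions is possible -/
  lamBound : ∀ cfg, lamIter δ (c + 1) cfg = none

namespace BPDG

variable {α : Type} [Fintype α]

/-- The configuration `δ(w)` reached after processing `w` from `(q0, z0)`. -/
def run (G : BPDG α) (w : List α) : Option (G.Q × List G.Γ) :=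
  runFrom G.δ G.c (G.q0, [G.z0]) w

/-- The bet placed on symbol `b` in the (possibly undefined) configuration
`ocfg`: the betting function evaluated at the current state and top stack
symbol (with a fair default bet if the configuration is undefined). -/
noncomputable def betAt (G : BPDG α) (ocfg : Option (G.Q × List G.Γ)) (b : α) : ℝ :=
  match ocfg with
  | some (q, a :: _) => (G.β q a b : ℝ)
  | _ => 1 / (Fintype.card α : ℝ)

/-- The capital after betting on `w`, starting from configuration `ocfg`
with capital 1. -/
noncomputable def martFrom (G : BPDG α) : Option (G.Q × List G.Γ) → List α → ℝ
  | _, [] => 1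
  | ocfg, b :: w =>
      (Fintype.card α : ℝ) * G.betAt ocfg b *
        G.martFrom (ocfg.bind (symStep G.δ G.c b)) w

/-- The martingale `d_G` of the gambler `G`:
`d_G(λ) = 1` and `d_G(wb) = |Σ| d_G(w) β(δ(w))(b)`. -/
noncomputable def mart (G : BPDG α) (w : List α) : ℝ :=
  G.martFrom (some (G.q0, [G.z0])) w

/-- The `s`-gale of `G`: `d^s_G(w) = |Σ|^{(s-1)|w|} d_G(w)`. -/
noncomputable def sgale (G : BPDG α) (s : ℝ) (w : List α) : ℝ :=
  (Fintype.card α : ℝ) ^ ((s - 1) * (w.length : ℝ)) * G.mart w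

/-- `G` is nonvanishing if `0 < β(q,z)(b) < 1` for all `q`, `z`, `b`. -/
def nonvanishing (G : BPDG α) : Prop :=
  ∀ q z b, 0 < G.β q z b ∧ G.β q z b < 1

/-- The number of stack symbols of `G`. -/
def numStackSymbols (G : BPDG α) : ℕ := @Fintype.card G.Γ G.fintypeΓ

end BPDG

/-- The bounded pushdown dimension of a sequence `S`: the infimum of all
`s ∈ [0,∞)` such that some bounded pushdown `s`-gale succeeds on `S`. -/
noncomputable def dimBPD {α : Type} [Fintype α] (S : ℕ → α) : ℝ :=
  sInf {s : ℝ | 0 ≤ s ∧ ∃ G : BPDG α, succeedsOn (G.sgale s) S}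

/-! ### Bounded pushdown compressors -/

/-- A bounded pushdown compressor (BPDC) over the input/output alphabet `α`. -/
structure BPDC (α : Type) [Fintype α] where
  /-- finite set of states -/
  Q : Type
  /-- finite stack alphabet -/
  Γ : Type
  fintypeQ : Fintype Q
  fintypeΓ : Fintype Γ
  /-- partial transition function; `none` as second argument is a `λ`-transition -/
  δ : Q → Option α → Γ → Option (Q × List Γ)
  /-- output function -/
  ν : Q → α → Γ → List α
  q0 : Q
  z0 : Γ
  /-- bound on the number of `λ`-transitions per input symbol -/
  c : ℕ
  det : ∀ q a, δ q none a = none ∨ ∀ b : α, δ q (some b) a = none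
  bottom : ∀ q (b : Option α), δ q b z0 = none ∨
    ∃ q' v, δ q b z0 = some (q', v ++ [z0])
  lamBound : ∀ cfg, lamIter δ (c + 1) cfg = none

namespace BPDC

variable {α : Type} [Fintype α]

/-- The configuration reached after processing `w` from `(q0, z0)`. -/
def run (C : BPDC α) (w : List α) : Option (C.Q × List C.Γ) :=
  runFrom C.δ C.c (C.q0, [C.z0]) w

/-- The output produced on reading symbol `b` in configuration `ocfg`. -/
def outAt (C : BPDC α) (ocfg : Option (C.Q × List C.Γ)) (b : α) : List α :=
  match ocfg with
  | some (q, a :: _) => C.ν q b a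
  | _ => []

/-- The output produced on input `w` starting from configuration `ocfg`. -/
def outFrom (C : BPDC α) : Option (C.Q × List C.Γ) → List α → List α
  | _, [] => []
  | ocfg, b :: w =>
      C.outAt ocfg b ++ C.outFrom (ocfg.bind (symStep C.δ C.c b)) w

/-- The output `C(w)` of the compressor on input `w`. -/
def output (C : BPDC α) (w : List α) : List α :=
  C.outFrom (some (C.q0, [C.z0])) w

/-- The output `ν(q, w, z)` produced on input `w` from state `q` with stack
content `z`. -/
def outputFrom (C : BPDC α) (q : C.Q) (z : List C.Γ) (w : List α) : List α :=
  C.outFrom (some (q, z)) w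

/-- `C` is information-lossless: `w ↦ (C(w), final state)` is one-to-one. -/
def IL (C : BPDC α) : Prop :=
  Function.Injective fun w : List α => (C.output w, (C.run w).map Prod.fst)

/-- The compression ratio of `C` on `S`: `liminf_n |C(S[0..n-1])| / n`. -/
noncomputable def compRatio (C : BPDC α) (S : ℕ → α) : ℝ :=
  Filter.liminf (fun n : ℕ => ((C.output (strPrefix S n)).length : ℝ) / n)
    Filter.atTop

/-- The number `|Q|` of states of `C`. -/
def numStates (C : BPDC α) : ℕ := @Fintype.card C.Q C.fintypeQ

/-- The number of stack symbols of `C`. -/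
def numStackSymbols (C : BPDC α) : ℕ := @Fintype.card C.Γ C.fintypeΓ

/-- The maximum length of any output of `ν` on a single input symbol. -/
def maxOut (C : BPDC α) : ℕ :=
  letI := C.fintypeQ
  letI := C.fintypeΓ
  Finset.univ.sup fun p : C.Q × α × C.Γ => (C.ν p.1 p.2.1 p.2.2).length

end BPDC

/-- The bounded pushdown compression ratio of `S`: the infimum of the
compression ratios achieved on `S` by information-lossless BPD compressors. -/
noncomputable def rhoBPD {α : Type} [Fintype α] (S : ℕ → α) : ℝ :=
  sInf {r : ℝ | ∃ C : BPDC α, C.IL ∧ C.compRatio S = r}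

/-! ### Finite-state gamblers -/

/-- A finite-state gambler over the alphabet `α`. -/
structure FSG (α : Type) [Fintype α] where
  /-- finite set of states -/
  Q : Type
  fintypeQ : Fintype Q
  δ : Q → α → Q
  β : Q → α → ℚ
  q0 : Q
  β_nonneg : ∀ q b, 0 ≤ β q b
  β_sum : ∀ q, ∑ b : α, β q b = 1

namespace FSG

variable {α : Type} [Fintype α]

/-- Capital after betting on `w` from state `q` with capital 1. -/
noncomputable def martFrom (G : FSG α) : G.Q → List α → ℝ
  | _, [] => 1
  | q, b :: w => (Fintype.card α : ℝ) * (G.β q b : ℝ) * G.martFrom (G.δ q b) w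

/-- The martingale of the finite-state gambler `G`. -/
noncomputable def mart (G : FSG α) (w : List α) : ℝ := G.martFrom G.q0 w

/-- The `s`-gale of `G`: `d^s_G(w) = |Σ|^{(s-1)|w|} d_G(w)`. -/
noncomputable def sgale (G : FSG α) (s : ℝ) (w : List α) : ℝ :=
  (Fintype.card α : ℝ) ^ ((s - 1) * (w.length : ℝ)) * G.mart w

end FSG

/-- Finite-state dimension of a sequence `S`. -/
noncomputable def dimFS {α : Type} [Fintype α] (S : ℕ → α) : ℝ :=
  sInf {s : ℝ | 0 ≤ s ∧ ∃ G : FSG α, succeedsOn (G.sgale s) S}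

/-! ### The Lempel-Ziv algorithm (over the binary alphabet) -/

/-- Greedy LZ78 parsing: the next phrase is the shortest nonempty prefix of the
remaining input that is not already a phrase in the dictionary (the empty
phrase `x₀ = λ` is implicitly in the dictionary); a final repeated phrase is
allowed. `fuel` is an upper bound on the number of phrases. -/
def lzParseAux : ℕ → List Bool → List (List Bool) → List (List Bool)
  | 0, rest, _ => if rest = [] then [] else [rest]
  | fuel + 1, rest, dict =>
    if rest = [] then []
    else
      match ((List.range rest.length).map fun i => rest.take (i + 1)).find?
          (fun p => !dict.contains p) with
      | none => [rest]
      | some p => p :: lzParseAux fuel (rest.drop p.length) (dict ++ [p])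

/-- The LZ78 parsing of `x` into phrases. -/
def lzParse (x : List Bool) : List (List Bool) := lzParseAux x.length x []

/-- The length of the LZ output on `x`: the `i`-th phrase (1-indexed) is encoded
by a code for the index `l(i) < i` of its longest proper prefix among the earlier
phrases, taking `⌈log₂ i⌉` bits, plus one bit for the new symbol. -/
def lzLen (x : List Bool) : ℕ :=
  ∑ i ∈ Finset.range (lzParse x).length, (Nat.clog 2 (i + 1) + 1)

/-- The LZ compression ratio of a sequence `S`. -/
noncomputable def rhoLZ (S : ℕ → Bool) : ℝ :=
  Filter.liminf (fun n : ℕ => (lzLen (strPrefix S n) : ℝ) / n) Filter.atTop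

namespace OneLam

theorem lamStar_append {α Q Γ : Type} (δ : Q → Option α → Γ → Option (Q × List Γ))
    (n : ℕ) : ∀ (q : Q) (s t : List Γ), n < s.length →
      lamStar δ n (q, s ++ t) = ((lamStar δ n (q, s)).1, (lamStar δ n (q, s)).2 ++ t) ∧
        (lamStar δ n (q, s)).2 ≠ [] := by
  induction n with
  | zero =>
    intro q s t h
    refine ⟨rfl, ?_⟩
    rintro h0
    simp only [lamStar] at h0
    simp [h0] at h
  | succ n ih =>
    intro q s t h
    match s, h with
    | a :: v, h =>
      cases hd : δ q none a with
      | none => simp [lamStar, lamStep, hd]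
      | some p =>
        have hlen : n < (p.2 ++ v).length := by
          simp only [List.length_append, List.length_cons] at h ⊢; omega
        have := ih p.1 (p.2 ++ v) t hlen
        simpa [lamStar, lamStep, hd] using this

theorem symStep_append {α Q Γ : Type} (δ : Q → Option α → Γ → Option (Q × List Γ))
    (n : ℕ) (b : α) (q : Q) (s t : List Γ) (h : n < s.length) :
      symStep δ n b (q, s ++ t) = (symStep δ n b (q, s)).map fun p => (p.1, p.2 ++ t) := by
  obtain ⟨h1, h2⟩ := lamStar_append δ n q s t h
  unfold symStep
  rw [h1]
  rcases hl : lamStar δ n (q, s) with ⟨q', _ | ⟨a, v⟩⟩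
  · simp [hl] at h2
  · cases hd : δ q' (some b) a <;> simp [hd]

theorem split_exists {Γ : Type} (k : ℕ) (hk : 0 < k) (R : List Γ) :
    ∃ p : {l : List Γ // l.length < k} × List {l : List Γ // l.length = k},
      R = p.1.1 ++ (p.2.map Subtype.val).flatten := by
  induction R with
  | nil => exact ⟨(⟨[], hk⟩, []), rfl⟩
  | cons a R ih =>
    obtain ⟨⟨⟨buf, hb⟩, bl⟩, h⟩ := ih
    by_cases hlt : buf.length + 1 < k
    · exact ⟨(⟨a :: buf, by simpa using hlt⟩, bl), by simp [h]⟩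
    · have hb' : buf.length < k := hb
      exact ⟨(⟨[], hk⟩, ⟨a :: buf, by simp only [List.length_cons]; omega⟩ :: bl),
        by simp [h]⟩

noncomputable def split {Γ : Type} (k : ℕ) (hk : 0 < k) (R : List Γ) :
    {l : List Γ // l.length < k} × List {l : List Γ // l.length = k} :=
  (split_exists k hk R).choose

theorem split_spec {Γ : Type} (k : ℕ) (hk : 0 < k) (R : List Γ) :
    (split k hk R).1.1 ++ ((split k hk R).2.map Subtype.val).flatten = R :=
  (split_exists k hk R).choose_spec.symm

/-- Content of a stack symbol of the new gambler (`none` is the bottom marker). -/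
def val {Γ : Type} {k : ℕ} : Option {l : List Γ // l.length = k} → List Γ
  | none => []
  | some l => l.1

/-- What remains below the popped symbol: the bottom marker is put back. -/
def keep {A : Type} : Option A → List (Option A)
  | none => [none]
  | some _ => []

/-- The bet on the top of a list, fair if the list is empty. -/
def betTop {α Q Γ : Type} [Fintype α] (β : Q → Γ → α → ℚ) (q : Q) : List Γ → α → ℚ
  | [], _ => 1 / (Fintype.card α : ℚ)
  | a :: _, b => β q a b

variable {α : Type} [Fintype α]

noncomputable def newδ (G : BPDG α) :
    (G.Q × {l : List G.Γ // l.length < G.c + 2}) → Option α →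
      Option {l : List G.Γ // l.length = G.c + 2} →
      Option ((G.Q × {l : List G.Γ // l.length < G.c + 2}) ×
        List (Option {l : List G.Γ // l.length = G.c + 2}))
  | _, none, _ => none
  | s, some b, C => (symStep G.δ G.c b (s.1, s.2.1 ++ val C)).map fun p =>
      ((p.1, (split (G.c + 2) (by omega) p.2).1),
        (split (G.c + 2) (by omega) p.2).2.map some ++ keep C)

theorem newδ_bottom (G : BPDG α) (s : G.Q × {l : List G.Γ // l.length < G.c + 2})
    (b : Option α) : newδ G s b none = none ∨ ∃ q' v, newδ G s b none = some (q', v ++ [none]) := by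
  cases b with
  | none => exact Or.inl rfl
  | some b =>
    cases h : symStep G.δ G.c b
        (s.1, s.2.1 ++ val (none : Option {l : List G.Γ // l.length = G.c + 2})) with
    | none => left; simp only [newδ, h, Option.map_none]
    | some p => right; simp only [newδ, h, Option.map_some]; exact ⟨_, _, rfl⟩

noncomputable def newG (hα : 2 ≤ Fintype.card α) (G : BPDG α) : BPDG α where
  Q := G.Q × {l : List G.Γ // l.length < G.c + 2}
  Γ := Option {l : List G.Γ // l.length = G.c + 2}
  fintypeQ := by
    haveI := G.fintypeQ
    haveI := G.fintypeΓ
    haveI : Finite {l : List G.Γ // l.length < G.c + 2} := List.finite_length_lt G.Γ (G.c + 2)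
    exact Fintype.ofFinite _
  fintypeΓ := by
    haveI := G.fintypeΓ
    haveI : Finite {l : List G.Γ // l.length = G.c + 2} := List.finite_length_eq G.Γ (G.c + 2)
    exact Fintype.ofFinite _
  δ := newδ G
  β := fun s C b => betTop G.β s.1 (s.2.1 ++ val C) b
  q0 := (G.q0, ⟨[G.z0], by simp⟩)
  z0 := none
  c := 1
  β_nonneg := by
    intro s C b
    cases s.2.1 ++ val C with
    | nil => simp only [betTop]; positivity
    | cons a v => exact G.β_nonneg _ _ _
  β_sum := by
    intro s C
    cases s.2.1 ++ val C with
    | nil =>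
      have : (Fintype.card α : ℚ) ≠ 0 := by
        have : Fintype.card α ≠ 0 := by omega
        exact_mod_cast this
      simp [betTop, this]
    | cons a v => exact G.β_sum _ _
  det := fun _ _ => Or.inl rfl
  bottom := newδ_bottom G
  lamBound := by
    rintro ⟨s, _ | ⟨a, v⟩⟩ <;> rfl

theorem mart_none (hα : 2 ≤ Fintype.card α) (G : BPDG α) (w : List α) :
    G.martFrom none w = (newG hα G).martFrom none w := by
  induction w with
  | nil => rfl
  | cons b w ih =>
    simp only [BPDG.martFrom, BPDG.betAt, Option.bind_none]
    rw [ih]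

/-- The capital function of `newG`, with the configuration type spelled out. -/
noncomputable def nm (hα : 2 ≤ Fintype.card α) (G : BPDG α)
    (o : Option ((G.Q × {l : List G.Γ // l.length < G.c + 2}) ×
        List (Option {l : List G.Γ // l.length = G.c + 2}))) (w : List α) : ℝ :=
  (newG hα G).martFrom o w

theorem nm_cons (hα : 2 ≤ Fintype.card α) (G : BPDG α)
    (s : G.Q × {l : List G.Γ // l.length < G.c + 2})
    (C : Option {l : List G.Γ // l.length = G.c + 2})
    (v : List (Option {l : List G.Γ // l.length = G.c + 2})) (b : α) (w : List α) :
    nm hα G (some (s, C :: v)) (b :: w) =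
      (Fintype.card α : ℝ) * ((betTop G.β s.1 (s.2.1 ++ val C) b : ℚ) : ℝ) *
        nm hα G ((newδ G s (some b) C).map fun p => (p.1, p.2 ++ v)) w := rfl

theorem mart_some (hα : 2 ≤ Fintype.card α) (G : BPDG α) (w : List α) :
    ∀ (q : G.Q) (buf : {l : List G.Γ // l.length < G.c + 2})
      (bl : List {l : List G.Γ // l.length = G.c + 2}),
      G.martFrom (some (q, buf.1 ++ (bl.map Subtype.val).flatten)) w =
        nm hα G (some ((q, buf), bl.map some ++ [none])) w := by
  induction w with
  | nil => intros; rfl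
  | cons b w ih =>
    intro q buf bl
    have key : ∀ (p : G.Q × List G.Γ) (bl' : List {l : List G.Γ // l.length = G.c + 2}),
        G.martFrom (some (p.1, p.2 ++ (bl'.map Subtype.val).flatten)) w =
        nm hα G (some ((p.1, (split (G.c + 2) (by omega) p.2).1),
          (split (G.c + 2) (by omega) p.2).2.map some ++ (bl'.map some ++ [none]))) w := by
      intro p bl'
      have := ih p.1 (split (G.c + 2) (by omega) p.2).1
        ((split (G.c + 2) (by omega) p.2).2 ++ bl')
      rw [List.map_append, List.flatten_append, ← List.append_assoc, split_spec,
        List.map_append, List.append_assoc] at this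
      exact this
    cases bl with
    | nil =>
      simp only [List.map_nil, List.flatten_nil, List.nil_append, List.append_nil]
      rw [nm_cons]
      simp only [BPDG.martFrom, Option.bind_some]
      congr 1
      · congr 1
        simp only [val, List.append_nil]
        cases buf.1 <;> simp [BPDG.betAt, betTop]
      · simp only [newδ, val, List.append_nil]
        cases h : symStep G.δ G.c b (q, buf.1) with
        | none => exact mart_none hα G w
        | some p =>
          have := key p []
          simpa [keep] using this
    | cons C bl =>
      have hlen : G.c < (buf.1 ++ C.1).length := by
        have := C.2
        rw [List.length_append]; omega
      simp only [List.map_cons, List.flatten_cons, List.cons_append]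
      rw [← List.append_assoc, nm_cons]
      simp only [BPDG.martFrom, Option.bind_some]
      congr 1
      · congr 1
        simp only [val]
        cases h : buf.1 ++ C.1 with
        | nil => simp [h] at hlen
        | cons a v => simp [BPDG.betAt, betTop]
      · rw [symStep_append _ _ _ _ _ _ hlen]
        simp only [newδ, val]
        cases h : symStep G.δ G.c b (q, buf.1 ++ C.1) with
        | none => exact mart_none hα G w
        | some p =>
          have := key p bl
          simpa [keep] using this

end OneLam

theorem bpdg_one_lambda_transition {α : Type} [Fintype α]
    (hα : 2 ≤ Fintype.card α) (G : BPDG α) :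
    ∃ G' : BPDG α, G'.c = 1 ∧ ∀ w : List α, G.mart w = G'.mart w :=
  ⟨OneLam.newG hα G, rfl, fun w =>
    OneLam.mart_some hα G w G.q0 ⟨[G.z0], by simp⟩ []⟩
end

section
/- For every bounded pushdown gambler G = (Q, Σ, Γ, δ, β, q₀, z₀, c) there exists a bounded pushdown gambler G′ = (Q′, Σ, {0, 1, z₀′}, δ′, β′, q₀′, z₀′, c′) whose stack alphabet has exactly three symbols, such that d_G(w) = d_{G′}(w) for all w ∈ Σ*. -/
/-! ### Construction of the three-symbol gambler -/

namespace ThreeSym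

theorem flat_length {Γ : Type} (e : Γ → List Bool) (L : ℕ) (hL : ∀ a, (e a).length = L)
    (s : List Γ) : (s.flatMap e).length = L * s.length := by
  induction s with
  | nil => simp
  | cons a s ih => simp [List.flatMap_cons, hL, ih]; ring

theorem flat_inj {Γ : Type} (e : Γ → List Bool) (L : ℕ) (hL : ∀ a, (e a).length = L)
    (hpos : 0 < L) (hinj : Function.Injective e) :
    ∀ s t : List Γ, s.flatMap e = t.flatMap e → s = t := by
  intro s
  induction s with
  | nil =>
    intro t h
    have := congrArg List.length h
    rw [flat_length e L hL, flat_length e L hL] at this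
    simp at this
    rcases this with h | h
    · omega
    · exact h.symm
  | cons a s ih =>
    intro t h
    cases t with
    | nil =>
      have := congrArg List.length h
      rw [flat_length e L hL, flat_length e L hL] at this
      simp at this
      omega
    | cons b t =>
      simp only [List.flatMap_cons] at h
      obtain ⟨h1, h2⟩ := List.append_inj h (by rw [hL, hL])
      rw [hinj h1, ih t h2]

theorem lamStar_append {α Q Γ : Type} (δ : Q → Option α → Γ → Option (Q × List Γ))
    (s2 : List Γ) : ∀ (n : ℕ) (q : Q) (s1 : List Γ), n ≤ s1.length →
      lamStar δ n (q, s1 ++ s2)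
        = ((lamStar δ n (q, s1)).1, (lamStar δ n (q, s1)).2 ++ s2) ∧
      s1.length ≤ (lamStar δ n (q, s1)).2.length + n := by
  intro n
  induction n with
  | zero => intro q s1 _; simp [lamStar]
  | succ n ih =>
    intro q s1 h
    cases s1 with
    | nil => simp at h
    | cons a v =>
      simp only [List.cons_append, lamStar, lamStep]
      cases hd : δ q none a with
      | none => simp
      | some p =>
        simp only [Option.map_some]
        have := ih p.1 (p.2 ++ v) (by simp at h ⊢; omega)
        rw [List.append_assoc] at this
        refine ⟨this.1, ?_⟩
        have h2 := this.2
        simp only [List.length_append, List.length_cons] at h2 ⊢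
        omega

theorem symStep_append {α Q Γ : Type} (δ : Q → Option α → Γ → Option (Q × List Γ))
    (c : ℕ) (b : α) (s2 : List Γ) (q : Q) (s1 : List Γ) (h : c + 1 ≤ s1.length) :
    symStep δ c b (q, s1 ++ s2) = (symStep δ c b (q, s1)).map fun p => (p.1, p.2 ++ s2) := by
  obtain ⟨h1, h2⟩ := lamStar_append δ s2 c q s1 (by omega)
  unfold symStep
  rw [h1]
  generalize lamStar δ c (q, s1) = x at *
  obtain ⟨q', s⟩ := x
  cases s with
  | nil => simp at h2; omega
  | cons a v =>
    simp only [List.cons_append]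
    cases δ q' (some b) a <;> simp

theorem symStep_length {α Q Γ : Type} (δ : Q → Option α → Γ → Option (Q × List Γ))
    (c : ℕ) (b : α) (q : Q) (s1 : List Γ) (h : c + 1 ≤ s1.length) (p : Q × List Γ)
    (hp : symStep δ c b (q, s1) = some p) : s1.length ≤ p.2.length + (c + 1) := by
  obtain ⟨-, h2⟩ := lamStar_append δ [] c q s1 (by omega)
  unfold symStep at hp
  generalize lamStar δ c (q, s1) = x at *
  obtain ⟨q', s⟩ := x
  cases s with
  | nil => simp at hp
  | cons a v =>
    simp only at hp
    cases hd : δ q' (some b) a with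
    | none => simp [hd] at hp
    | some r =>
      simp only [hd, Option.map_some, Option.some.injEq] at hp
      subst hp
      simp only [List.length_append, List.length_cons] at h2 ⊢
      omega

variable {α : Type} [Fintype α]

theorem push_bottom (G : BPDG α) (q : G.Q) (b : Option α) (a : G.Γ) (v : List G.Γ)
    (h : ∃ u, a :: v = u ++ [G.z0]) (p : G.Q × List G.Γ) (hp : G.δ q b a = some p) :
    ∃ u, p.2 ++ v = u ++ [G.z0] := by
  obtain ⟨u, hu⟩ := h
  cases u with
  | nil =>
    simp only [List.nil_append, List.cons.injEq] at hu
    obtain ⟨rfl, rfl⟩ := hu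
    rcases G.bottom q b with h | ⟨q', u, h⟩
    · rw [h] at hp; simp at hp
    · rw [h] at hp
      simp only [Option.some.injEq] at hp
      subst hp
      exact ⟨u, by simp⟩
  | cons a' u =>
    simp only [List.cons_append, List.cons.injEq] at hu
    exact ⟨p.2 ++ u, by rw [hu.2, List.append_assoc]⟩

theorem lamStar_bottom (G : BPDG α) : ∀ (n : ℕ) (q : G.Q) (s : List G.Γ),
    (∃ u, s = u ++ [G.z0]) → ∃ u, (lamStar G.δ n (q, s)).2 = u ++ [G.z0] := by
  intro n
  induction n with
  | zero => intro q s h; simpa [lamStar] using h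
  | succ n ih =>
    intro q s h
    cases s with
    | nil => obtain ⟨u, hu⟩ := h; simp at hu
    | cons a v =>
      simp only [lamStar, lamStep]
      cases hd : G.δ q none a with
      | none => simpa using h
      | some p => exact ih _ _ (push_bottom G q none a v h p hd)

theorem symStep_bottom (G : BPDG α) (b : α) (q : G.Q) (s : List G.Γ)
    (h : ∃ u, s = u ++ [G.z0]) (p : G.Q × List G.Γ)
    (hp : symStep G.δ G.c b (q, s) = some p) : ∃ u, p.2 = u ++ [G.z0] := by
  have h2 := lamStar_bottom G G.c q s h
  unfold symStep at hp
  generalize lamStar G.δ G.c (q, s) = x at *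
  obtain ⟨q', s⟩ := x
  cases s with
  | nil => simp at hp
  | cons a v =>
    simp only at hp
    cases hd : G.δ q' (some b) a with
    | none => simp [hd] at hp
    | some r =>
      simp only [hd, Option.map_some, Option.some.injEq] at hp
      subst hp
      exact push_bottom G q' (some b) a v h2 r hd

/-- States: a state of `G` with a bounded buffer of bits. -/
abbrev St (G : BPDG α) (M : ℕ) : Type := G.Q × {l : List Bool // l.length ≤ M}

open Classical in
/-- The transition function of the simulating machine: `λ`-transitions refill the buffer,
input transitions simulate a whole `symStep` of `G`. -/
noncomputable def dl (G : BPDG α) (e : G.Γ → List Bool) (M : ℕ) :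
    St G M → Option α → Option Bool → Option (St G M × List (Option Bool))
  | (_, _), none, none => none
  | (q, l), none, some x =>
    if h : l.1.length < M then some ((q, ⟨l.1 ++ [x], by simp; omega⟩), []) else none
  | (q, l), some b, top =>
    if l.1.length < M ∧ top ≠ none then none
    else if h : ∃ s : List G.Γ, s.flatMap e = l.1 then
      (symStep G.δ G.c b (q, h.choose)).map fun p =>
        ((p.1, ⟨(p.2.flatMap e).take M, by simp⟩),
          ((p.2.flatMap e).drop M).map some ++ [top])
    else none

open Classical in
/-- The betting function of the simulating machine. -/
noncomputable def bt (G : BPDG α) (e : G.Γ → List Bool) (M : ℕ) :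
    St G M → Option Bool → α → ℚ := fun ql _ b =>
  if h : ∃ a : G.Γ, e a <+: ql.2.1 then G.β ql.1 h.choose b
  else 1 / (Fintype.card α : ℚ)

theorem lamIter_none (G : BPDG α) (e : G.Γ → List Bool) (M : ℕ) :
    ∀ (n : ℕ) (q : G.Q) (l : {l : List Bool // l.length ≤ M}) (s : List (Option Bool)),
      M < n + l.1.length → lamIter (dl G e M) n ((q, l), s) = none := by
  intro n
  induction n with
  | zero => intro q l s h; have := l.2; omega
  | succ n ih =>
    intro q l s h
    match s with
    | [] => simp [lamIter, lamStep]
    | none :: s => simp [lamIter, lamStep, dl]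
    | some x :: s =>
      simp only [lamIter, lamStep, dl]
      split
      · simp only [Option.map_some, Option.bind_some]
        apply ih
        simp; omega
      · simp

theorem lamStar_refill (G : BPDG α) (e : G.Γ → List Bool) (M : ℕ) :
    ∀ (n : ℕ) (q : G.Q) (l : {l : List Bool // l.length ≤ M}) (t : List Bool),
      M ≤ n + l.1.length → ∃ (l' : {l : List Bool // l.length ≤ M}) (t' : List Bool),
        lamStar (dl G e M) n ((q, l), t.map some ++ [none])
          = ((q, l'), t'.map some ++ [none]) ∧
        l'.1 ++ t' = l.1 ++ t ∧ (l'.1.length = M ∨ t' = []) := by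
  intro n
  induction n with
  | zero => intro q l t h; exact ⟨l, t, rfl, rfl, Or.inl (by have := l.2; omega)⟩
  | succ n ih =>
    intro q l t h
    match t with
    | [] => exact ⟨l, [], by simp [lamStar, lamStep, dl], rfl, Or.inr rfl⟩
    | x :: t =>
      by_cases hl : l.1.length < M
      · obtain ⟨l', t', h1, h2, h3⟩ := ih q ⟨l.1 ++ [x], by simp; omega⟩ t (by simp; omega)
        refine ⟨l', t', ?_, ?_, h3⟩
        · simp only [List.map_cons, List.cons_append, lamStar, lamStep, dl, hl, dif_pos,
            Option.map_some, List.nil_append]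
          exact h1
        · rw [h2]; simp
      · refine ⟨l, x :: t, ?_, rfl, Or.inl (by have := l.2; omega)⟩
        simp [lamStar, lamStep, dl, hl]

/-- The simulating gambler. -/
noncomputable def sim (hα : 2 ≤ Fintype.card α) (G : BPDG α) (e : G.Γ → List Bool) (M : ℕ)
    (hM : (e G.z0).length ≤ M) : BPDG α where
  Q := St G M
  Γ := Option Bool
  fintypeQ := by
    haveI := G.fintypeQ
    haveI : Finite {l : List Bool // l.length ≤ M} := (List.finite_length_le Bool M).to_subtype
    exact Fintype.ofFinite _
  fintypeΓ := inferInstance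
  δ := dl G e M
  β := bt G e M
  q0 := (G.q0, ⟨e G.z0, hM⟩)
  z0 := none
  c := M
  β_nonneg := by
    intro q a b
    unfold bt
    split
    · exact G.β_nonneg _ _ _
    · positivity
  β_sum := by
    intro q a
    unfold bt
    split
    · exact G.β_sum _ _
    · simp only [Finset.sum_const, Finset.card_univ, nsmul_eq_mul]
      have : (Fintype.card α : ℚ) ≠ 0 := by
        have : Fintype.card α ≠ 0 := by omega
        exact_mod_cast this
      field_simp
  det := by
    rintro ⟨q, l⟩ a
    match a with
    | none => left; simp [dl]
    | some x =>
      by_cases hl : l.1.length < M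
      · right; intro b; simp [dl, hl]
      · left; simp [dl, hl]
  bottom := by
    rintro ⟨q, l⟩ b
    match b with
    | none => left; simp [dl]
    | some b =>
      simp only [dl]
      split
      · left; rfl
      · split
        · rename_i h
          cases symStep G.δ G.c b (q, h.choose) with
          | none => left; rfl
          | some p => right; exact ⟨_, _, rfl⟩
        · left; rfl
  lamBound := by
    rintro ⟨⟨q, l⟩, s⟩
    exact lamIter_none G e M (M + 1) q l s (by omega)

/-- Related configurations. -/
def Rel (G : BPDG α) (e : G.Γ → List Bool) (L M : ℕ) (x : G.Q × List G.Γ)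
    (y : St G M × List (Option Bool)) : Prop :=
  y.1.1 = x.1 ∧ (∃ u, x.2 = u ++ [G.z0]) ∧ L ≤ y.1.2.1.length ∧
    ∃ t : List Bool, y.2 = t.map some ++ [none] ∧ y.1.2.1 ++ t = x.2.flatMap e

/-- Optional configurations: both undefined, or both defined and related. -/
def ORel (G : BPDG α) (e : G.Γ → List Bool) (L M : ℕ) (x : Option (G.Q × List G.Γ))
    (y : Option (St G M × List (Option Bool))) : Prop :=
  (x = none ∧ y = none) ∨ ∃ x' y', x = some x' ∧ y = some y' ∧ Rel G e L M x' y'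

theorem rel_bet (hα : 2 ≤ Fintype.card α) (G : BPDG α) (e : G.Γ → List Bool) (L M : ℕ)
    (hM : (e G.z0).length ≤ M) (hL : ∀ a, (e a).length = L) (hinj : Function.Injective e)
    (x : G.Q × List G.Γ) (y : St G M × List (Option Bool)) (h : Rel G e L M x y) (b : α) :
    G.betAt (some x) b = (sim hα G e M hM).betAt (some y) b := by
  obtain ⟨q, s⟩ := x
  obtain ⟨⟨q', l⟩, stk⟩ := y
  obtain ⟨h1, ⟨u, h2⟩, h3, t, h4, h5⟩ := h
  simp only at h1 h2 h3 h4 h5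
  subst h1 h4
  cases s with
  | nil => simp at h2
  | cons a v =>
    have hpre : e a <+: l.1 := by
      have h6 : e a <+: l.1 ++ t := by rw [h5, List.flatMap_cons]; exact List.prefix_append _ _
      exact List.prefix_of_prefix_length_le h6 (List.prefix_append _ _) (by rw [hL]; exact h3)
    have hex : ∃ a : G.Γ, e a <+: l.1 := ⟨a, hpre⟩
    have hch : hex.choose = a := by
      apply hinj
      have := hex.choose_spec
      exact (List.prefix_of_prefix_length_le this hpre (by rw [hL, hL])).eq_of_length
        (by rw [hL, hL])
    have hb : bt G e M (q', l) = fun _ b => G.β q' a b := by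
      funext _ b
      unfold bt
      rw [dif_pos hex, hch]
    have key : ∀ top, (bt G e M (q', l) top b : ℝ) = (G.β q' a b : ℝ) := by
      intro top; rw [hb]
    cases t with
    | nil => exact (key none).symm
    | cons x t => exact (key (some x)).symm

theorem rel_step (hα : 2 ≤ Fintype.card α) (G : BPDG α) (e : G.Γ → List Bool) (L M : ℕ)
    (hM : (e G.z0).length ≤ M) (hL : ∀ a, (e a).length = L) (hinj : Function.Injective e)
    (hpos : 0 < L) (hMM : M = L * (G.c + 2))
    (x : G.Q × List G.Γ) (y : St G M × List (Option Bool)) (h : Rel G e L M x y) (b : α) :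
    ORel G e L M (symStep G.δ G.c b x) (symStep (dl G e M) M b y) := by
  obtain ⟨q, s⟩ := x
  obtain ⟨⟨q', l⟩, stk⟩ := y
  obtain ⟨h1, h2, h3, t, h4, h5⟩ := h
  simp only at h1 h2 h3 h4 h5
  subst h1 h4
  obtain ⟨l', t', r1, r2, r3⟩ := lamStar_refill G e M M q' l t (by omega)
  obtain ⟨s1, s2, hs, hl', ht', hc⟩ : ∃ s1 s2, s = s1 ++ s2 ∧ s1.flatMap e = l'.1 ∧
      s2.flatMap e = t' ∧ (s2 = [] ∨ G.c + 2 ≤ s1.length) := by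
    rcases r3 with r3 | r3
    · have hlen := congrArg List.length (r2.trans h5)
      rw [flat_length e L hL, List.length_append, r3, hMM] at hlen
      have hk : G.c + 2 ≤ s.length := by
        have : L * (G.c + 2) ≤ L * s.length := by omega
        exact Nat.le_of_mul_le_mul_left this hpos
      refine ⟨s.take (G.c + 2), s.drop (G.c + 2), by simp, ?_⟩
      have heq : (s.take (G.c + 2)).flatMap e ++ (s.drop (G.c + 2)).flatMap e = l'.1 ++ t' := by
        rw [← List.flatMap_append, List.take_append_drop, r2, h5]
      obtain ⟨e1, e2⟩ := List.append_inj heq (by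
        rw [flat_length e L hL, r3, hMM, List.length_take, min_eq_left hk])
      exact ⟨e1, e2, Or.inr (by simp [hk])⟩
    · subst r3
      exact ⟨s, [], by simp, by rw [← h5, ← r2]; simp, rfl, Or.inl rfl⟩
  have hex : ∃ s : List G.Γ, s.flatMap e = l'.1 := ⟨s1, hl'⟩
  have hch : hex.choose = s1 :=
    flat_inj e L hL hpos hinj _ _ (hex.choose_spec.trans hl'.symm)
  have hsim : symStep (dl G e M) M b ((q', l), t.map some ++ [none]) =
      (symStep G.δ G.c b (q', s1)).map fun p =>
        (((p.1, ⟨(p.2.flatMap e).take M, by simp⟩) : St G M),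
          ((p.2.flatMap e).drop M).map some ++ (t'.map some ++ [none])) := by
    unfold symStep
    rw [r1]
    change _ = (symStep G.δ G.c b (q', s1)).map _
    cases t' with
    | nil =>
      simp only [List.map_nil, List.nil_append, dl, ne_eq, not_true_eq_false, and_false,
        if_false, dif_pos hex, hch]
      cases symStep G.δ G.c b (q', s1) <;> simp
    | cons x t' =>
      have hlen : ¬ (l'.1.length < M) := by
        rcases r3 with r3 | r3
        · omega
        · simp at r3
      simp only [List.map_cons, List.cons_append, dl, hlen, false_and,
        if_false, dif_pos hex, hch]
      cases symStep G.δ G.c b (q', s1) <;> simp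
  have horig : symStep G.δ G.c b (q', s) =
      (symStep G.δ G.c b (q', s1)).map fun p => (p.1, p.2 ++ s2) := by
    rcases hc with hc | hc
    · subst hc; subst hs
      cases h : symStep G.δ G.c b (q', s1) <;> simp [h]
    · rw [hs]; exact symStep_append _ _ _ _ _ _ (by omega)
  have hbot := symStep_bottom G b q' s h2
  rw [hsim]
  rw [horig] at hbot ⊢
  cases hp : symStep G.δ G.c b (q', s1) with
  | none => left; simp
  | some p =>
    right
    rw [hp] at hbot
    have hbot' := hbot _ rfl
    refine ⟨_, _, rfl, rfl, rfl, hbot', ?_, (p.2.flatMap e).drop M ++ t', by simp, ?_⟩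
    · have hne : 1 ≤ p.2.length := by
        rcases hc with hc | hc
        · subst hc
          obtain ⟨u, hu⟩ := hbot'
          have := congrArg List.length hu
          simp at this
          omega
        · have := symStep_length G.δ G.c b q' s1 (by omega) p hp
          omega
      simp only [List.length_take, flat_length e L hL]
      rw [hMM]
      apply le_min
      · exact Nat.le_mul_of_pos_right _ (by omega)
      · exact Nat.le_mul_of_pos_right _ (by omega)
    · simp only [List.flatMap_append, ht']
      rw [← List.append_assoc, List.take_append_drop]

theorem orel_mart (hα : 2 ≤ Fintype.card α) (G : BPDG α) (e : G.Γ → List Bool) (L M : ℕ)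
    (hM : (e G.z0).length ≤ M) (hL : ∀ a, (e a).length = L) (hinj : Function.Injective e)
    (hpos : 0 < L) (hMM : M = L * (G.c + 2)) :
    ∀ (w : List α) (x : Option (G.Q × List G.Γ)) (y : Option (St G M × List (Option Bool))),
      ORel G e L M x y → G.martFrom x w = (sim hα G e M hM).martFrom y w := by
  intro w
  induction w with
  | nil => intro x y _; simp [BPDG.martFrom]
  | cons b w ih =>
    rintro x y (⟨rfl, rfl⟩ | ⟨x', y', rfl, rfl, h⟩)
    · have h1 := ih none none (Or.inl ⟨rfl, rfl⟩)
      unfold BPDG.martFrom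
      exact congrArg₂ (· * ·) rfl h1
    · have h1 := ih _ _ (rel_step hα G e L M hM hL hinj hpos hMM x' y' h b)
      have h2 := rel_bet hα G e L M hM hL hinj x' y' h b
      unfold BPDG.martFrom
      exact congrArg₂ (· * ·) (congrArg _ h2) h1

end ThreeSym

/-- For every bounded pushdown gambler `G` there is a bounded
pushdown gambler `G'` whose stack alphabet has exactly three symbols
(`{0, 1, z₀'}`) such that `d_G(w) = d_{G'}(w)` for all `w ∈ Σ*`. -/
theorem bpdg_three_stack_symbols {α : Type} [Fintype α]
    (hα : 2 ≤ Fintype.card α) (G : BPDG α) :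
    ∃ G' : BPDG α, G'.numStackSymbols = 3 ∧ ∀ w : List α, G.mart w = G'.mart w := by
  classical
  haveI := G.fintypeΓ
  let e : G.Γ → List Bool := fun a =>
    List.ofFn fun i : Fin (Fintype.card G.Γ) => decide (i = Fintype.equivFin G.Γ a)
  have hL : ∀ a, (e a).length = Fintype.card G.Γ := fun a => by simp [e]
  have hinj : Function.Injective e := by
    intro a a' h
    have h1 := congrFun (List.ofFn_injective h) (Fintype.equivFin G.Γ a)
    simpa using h1
  have hpos : 0 < Fintype.card G.Γ := Fintype.card_pos_iff.mpr ⟨G.z0⟩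
  have hM : (e G.z0).length ≤ Fintype.card G.Γ * (G.c + 2) := by
    rw [hL]; exact Nat.le_mul_of_pos_right _ (by omega)
  refine ⟨ThreeSym.sim hα G e _ hM, ?_, ?_⟩
  · change Fintype.card (Option Bool) = 3
    simp
  · intro w
    refine ThreeSym.orel_mart hα G e _ _ hM hL hinj hpos rfl w _ _ (Or.inr ⟨_, _, rfl, rfl, ?_⟩)
    refine ⟨rfl, ⟨[], rfl⟩, ?_, [], rfl, ?_⟩
    · change _ ≤ (e G.z0).length
      rw [hL]
    · change e G.z0 ++ [] = _
      simp
end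

section
/- For every bounded pushdown compressor C = (Q, Σ, Γ, δ, ν, q₀, z₀, c) there exists a bounded pushdown compressor C′ = (Q′, Σ, {0, 1, z₀′}, δ′, ν′, q₀′, z₀′, c′) whose stack alphabet has exactly three symbols, such that C(w) = C′(w) for every w ∈ Σ*. -/
namespace ThreeStack

variable {α Q Γ : Type}

lemma lamStar_append (δ : Q → Option α → Γ → Option (Q × List Γ)) (t : List Γ) :
    ∀ (n : ℕ) (q : Q) (s : List Γ), n < s.length →
      lamStar δ n (q, s ++ t) = ((lamStar δ n (q, s)).1, (lamStar δ n (q, s)).2 ++ t) ∧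
      s.length ≤ (lamStar δ n (q, s)).2.length + n := by
  intro n
  induction n with
  | zero => intro q s _; simp [lamStar]
  | succ n ih =>
    intro q s hs
    rcases s with _ | ⟨a, v⟩
    · simp at hs
    · simp only [List.length_cons] at hs
      rcases hd : δ q none a with _ | ⟨q', p⟩
      · simp [lamStar, lamStep, hd]
      · have := ih q' (p ++ v) (by simp; omega)
        simp only [List.append_assoc] at this
        simp only [lamStar, lamStep, hd, List.cons_append, Option.map_some]
        refine ⟨this.1, ?_⟩
        have h2 := this.2
        simp only [List.length_append, List.length_cons] at h2 ⊢
        omega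

lemma symStep_append (δ : Q → Option α → Γ → Option (Q × List Γ)) (c : ℕ) (b : α)
    (q : Q) (s t : List Γ) (h : t = [] ∨ c + 2 ≤ s.length) :
    symStep δ c b (q, s ++ t) = (symStep δ c b (q, s)).map (fun p => (p.1, p.2 ++ t)) ∧
    (t = [] ∨ ∀ p, symStep δ c b (q, s) = some p → p.2 ≠ []) := by
  rcases h with rfl | h
  · simp
  · obtain ⟨h1, h2⟩ := lamStar_append δ t c q s (by omega)
    rcases hr : lamStar δ c (q, s) with ⟨q1, u⟩
    rw [hr] at h1 h2
    rcases u with _ | ⟨a, u⟩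
    · simp at h2; omega
    · rcases u with _ | ⟨a', u⟩
      · simp at h2; omega
      · simp only [symStep, h1, hr, List.cons_append]
        rcases δ q1 (some b) a with _ | p
        · simp
        · simp

/-- A one-hot code for the symbols of a finite type. -/
noncomputable def code [Fintype Γ] (a : Γ) : List Bool :=
  List.ofFn fun i : Fin (Fintype.card Γ) => decide (i = Fintype.equivFin Γ a)

lemma code_length [Fintype Γ] (a : Γ) : (code a).length = Fintype.card Γ := by
  simp [code]

lemma code_inj [Fintype Γ] {a b : Γ} (h : code a = code b) : a = b := by
  have := List.ofFn_injective h
  have h2 := congrFun this (Fintype.equivFin Γ a)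
  simpa using h2

/-- The code extended to lists. -/
noncomputable def enc [Fintype Γ] (v : List Γ) : List Bool := v.flatMap code

lemma enc_inj [Fintype Γ] : Function.Injective (enc (Γ := Γ)) := by
  intro v
  induction v with
  | nil =>
    intro w h
    rcases w with _ | ⟨b, w⟩
    · rfl
    · have := congrArg List.length h
      have hp : 0 < Fintype.card Γ := Fintype.card_pos_iff.mpr ⟨b⟩
      simp [enc, code_length] at this
      omega
  | cons a v ih =>
    intro w h
    have hp : 0 < Fintype.card Γ := Fintype.card_pos_iff.mpr ⟨a⟩
    rcases w with _ | ⟨b, w⟩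
    · have := congrArg List.length h
      simp [enc, code_length] at this
      omega
    · simp only [enc, List.flatMap_cons] at h
      obtain ⟨h1, h2⟩ := List.append_inj h (by simp [code_length])
      rw [code_inj h1, ih h2]

lemma enc_append [Fintype Γ] (v w : List Γ) : enc (v ++ w) = enc v ++ enc w := by
  simp [enc]

lemma enc_length [Fintype Γ] (v : List Γ) : (enc v).length = v.length * Fintype.card Γ := by
  induction v with
  | nil => simp [enc]
  | cons a v ih => simp only [enc, List.flatMap_cons, List.length_append, code_length,
      List.length_cons] at *; rw [ih]; ring

/-- Decoder. -/
noncomputable def dec [Fintype Γ] : List Bool → List Γ := Function.invFun enc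

lemma dec_enc [Fintype Γ] (v : List Γ) : dec (enc v) = v :=
  Function.leftInverse_invFun enc_inj v

lemma enc_take [Fintype Γ] (v : List Γ) (m : ℕ) :
    (enc v).take (m * Fintype.card Γ) = enc (v.take m) ∧
    (enc v).drop (m * Fintype.card Γ) = enc (v.drop m) := by
  have hv : enc v = enc (v.take m) ++ enc (v.drop m) := by
    rw [← enc_append, List.take_append_drop]
  rcases le_total m v.length with h | h
  · have hl : (enc (v.take m)).length = m * Fintype.card Γ := by
      rw [enc_length, List.length_take, min_eq_left h]
    rw [hv, ← hl]; simp
  · have : (enc v).length ≤ m * Fintype.card Γ := by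
      rw [enc_length]; gcongr
    rw [List.take_of_length_le this, List.drop_of_length_le this, List.take_of_length_le h,
      List.drop_of_length_le h]
    simp [enc]

/-- States of the new machine: old state, top symbol, bit buffer. -/
abbrev St (Q Γ : Type) (N : ℕ) : Type := Q × Γ × {l : List Bool // l.length ≤ N}

/-- Transition function of the new machine. -/
noncomputable def newδ [Fintype Γ] (δ : Q → Option α → Γ → Option (Q × List Γ)) (c N : ℕ) :
    St Q Γ N → Option α → Option Bool → Option (St Q Γ N × List (Option Bool))
  | (q, a, l), none, some x =>
      if h : l.1.length < N then
        some ((q, a, ⟨l.1 ++ [x], by simp; omega⟩), [])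
      else none
  | _, none, none => none
  | (q, a, l), some b, x =>
      if l.1.length < N ∧ x ≠ none then none
      else match symStep δ c b (q, a :: dec l.1) with
        | some (q', a' :: u) =>
            some ((q', a', ⟨[], by simp⟩), (enc u).map some ++ [x])
        | _ => none

lemma newδ_lam [Fintype Γ] (δ : Q → Option α → Γ → Option (Q × List Γ)) (c N : ℕ)
    (s : St Q Γ N) (x : Option Bool) (p : St Q Γ N × List (Option Bool))
    (h : newδ δ c N s none x = some p) : p.1.2.2.1.length = s.2.2.1.length + 1 := by
  obtain ⟨q, a, l⟩ := s
  rcases x with _ | x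
  · simp [newδ] at h
  · simp only [newδ] at h
    split_ifs at h
    simp only [Option.some.injEq] at h
    subst h
    simp

lemma newδ_iter [Fintype Γ] (δ : Q → Option α → Γ → Option (Q × List Γ)) (c N : ℕ) :
    ∀ (n : ℕ) (s p : St Q Γ N × List (Option Bool)),
    lamIter (newδ δ c N) n s = some p → p.1.2.2.1.length = s.1.2.2.1.length + n := by
  intro n
  induction n with
  | zero => intro s p h; simp only [lamIter, Option.some.injEq] at h; subst h; rfl
  | succ n ih =>
    rintro ⟨s, st⟩ p h
    rcases st with _ | ⟨x, st⟩
    · simp [lamIter, lamStep] at h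
    · simp only [lamIter, lamStep] at h
      rcases hd : newδ δ c N s none x with _ | r
      · simp [hd] at h
      · simp only [hd, Option.map_some, Option.bind_some] at h
        have h1 := ih _ _ h
        have h2 := newδ_lam δ c N s x r hd
        simp only at h1 ⊢
        omega

lemma newδ_star [Fintype Γ] (δ : Q → Option α → Γ → Option (Q × List Γ)) (c N : ℕ)
    (q : Q) (a : Γ) :
    ∀ (n : ℕ) (l : {l : List Bool // l.length ≤ N}) (s : List Bool) (_ : l.1.length + n = N)
      (hl' : (l.1 ++ s.take n).length ≤ N),
    lamStar (newδ δ c N) n ((q, a, l), s.map some ++ [none]) =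
      ((q, a, ⟨l.1 ++ s.take n, hl'⟩), (s.drop n).map some ++ [none]) := by
  intro n
  induction n with
  | zero => intro l s _ _; simp [lamStar]
  | succ n ih =>
    intro l s hl hl'
    rcases s with _ | ⟨x, s⟩
    · simp [lamStar, lamStep, newδ]
    · have hlt : l.1.length < N := by omega
      simp only [lamStar, List.map_cons, List.cons_append, lamStep, newδ, hlt, dite_true,
        Option.map_some, List.nil_append]
      rw [ih]
      · simp
      · simp; omega
      · simpa using hl'

/-- The new compressor. -/
noncomputable def newC [Fintype α] (C : BPDC α) : BPDC α :=
  letI := C.fintypeΓ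
  letI := C.fintypeQ
  let N := (C.c + 1) * Fintype.card C.Γ
  { Q := St C.Q C.Γ N
    Γ := Option Bool
    fintypeQ := by
      haveI : Finite {l : List Bool // l.length ≤ N} := (List.finite_length_le Bool N).to_subtype
      exact Fintype.ofFinite _
    fintypeΓ := inferInstance
    δ := newδ C.δ C.c N
    ν := fun s b _ => C.ν s.1 b s.2.1
    q0 := (C.q0, C.z0, ⟨[], by simp⟩)
    z0 := none
    c := N
    det := by
      rintro ⟨q, a, l⟩ x
      rcases x with _ | x
      · left; rfl
      · by_cases h : l.1.length < N
        · right; intro b; simp [newδ, h]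
        · left; simp [newδ, h]
    bottom := by
      rintro ⟨q, a, l⟩ o
      rcases o with _ | b
      · left; rfl
      · simp only [newδ]
        rw [if_neg (by simp)]
        split
        · right; exact ⟨_, _, rfl⟩
        · left; rfl
    lamBound := by
      intro cfg
      by_contra h
      obtain ⟨p, hp⟩ := Option.ne_none_iff_exists'.mp h
      have h1 := newδ_iter _ _ _ _ _ _ hp
      have h2 := p.1.2.2.2
      omega }

lemma newδ_symStep [Fintype Γ] (δ : Q → Option α → Γ → Option (Q × List Γ)) (c N : ℕ)
    (hN : N = (c + 1) * Fintype.card Γ) (b : α) (q : Q) (a : Γ) (v : List Γ) :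
    (∃ q' a' u, symStep δ c b (q, a :: v) = some (q', a' :: u) ∧
      symStep (newδ δ c N) N b ((q, a, ⟨[], by simp⟩), (enc v).map some ++ [none]) =
        some ((q', a', ⟨[], by simp⟩), (enc u).map some ++ [none])) ∨
    ((symStep δ c b (q, a :: v) = none ∨ ∃ q', symStep δ c b (q, a :: v) = some (q', [])) ∧
      symStep (newδ δ c N) N b ((q, a, ⟨[], by simp⟩), (enc v).map some ++ [none]) = none) := by
  obtain ⟨ht, hd⟩ := enc_take v (c + 1)
  rw [← hN] at ht hd
  have hstar := newδ_star δ c N q a N ⟨[], by simp⟩ (enc v) (by simp) (by simp)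
  simp only [List.nil_append, ht, hd] at hstar
  have hvl : v.drop (c + 1) = [] ∨ c + 2 ≤ (a :: v.take (c + 1)).length := by
    simp only [List.drop_eq_nil_iff, List.length_cons, List.length_take]; omega
  obtain ⟨hs, hne⟩ := symStep_append δ c b q _ _ hvl
  rw [List.cons_append, List.take_append_drop] at hs
  -- the new step
  have hnew : symStep (newδ δ c N) N b ((q, a, ⟨[], by simp⟩), (enc v).map some ++ [none]) =
      match symStep δ c b (q, a :: v.take (c + 1)) with
        | some (q', a' :: u) =>
            some ((q', a', ⟨[], by simp⟩),
              (enc (u ++ v.drop (c + 1))).map some ++ [none])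
        | _ => none := by
    simp only [symStep, hstar]
    have key : ∀ (x : Option Bool) (r : List (Option Bool)) (hl),
        (x ≠ none → N ≤ (enc (v.take (c + 1))).length) →
        (newδ δ c N (q, a, ⟨enc (v.take (c + 1)), hl⟩) (some b) x).map
          (fun p => (p.1, p.2 ++ r)) =
        match symStep δ c b (q, a :: v.take (c + 1)) with
        | some (q', a' :: u) =>
            some ((q', a', ⟨[], by simp⟩), (enc u).map some ++ (x :: r))
        | _ => none := by
      intro x r hl hx
      simp only [newδ, dec_enc]
      rw [if_neg (by rintro ⟨h1, h2⟩; have := hx h2; omega)]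
      rcases symStep δ c b (q, a :: v.take (c + 1)) with _ | ⟨q', _ | ⟨a', u⟩⟩ <;> simp
    rcases hD : enc (v.drop (c + 1)) with _ | ⟨x, r⟩
    · have := key none [] (by rw [← ht]; simp) (by simp)
      simp only [List.map_nil, List.nil_append]
      rw [this]
      simp only [enc_append, hD, List.append_nil]
      rfl
    · have := key (some x) (r.map some ++ [none]) (by rw [← ht]; simp) (by
        intro _
        have h3 := congrArg List.length hd
        rw [hD] at h3
        rw [← ht, List.length_take]
        simp only [List.length_drop, List.length_cons] at h3
        omega)
      simp only [List.map_cons, List.cons_append]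
      rw [this]
      simp only [enc_append, hD, List.map_append, List.map_cons, List.append_assoc,
        List.cons_append]
      rfl
  rcases hr : symStep δ c b (q, a :: v.take (c + 1)) with _ | ⟨q', _ | ⟨a', u⟩⟩
  · right
    simp only [hr, Option.map_none] at hs hnew
    exact ⟨Or.inl hs, hnew⟩
  · right
    simp only [hr] at hs hnew
    rcases hne with h0 | h0
    · refine ⟨Or.inr ⟨q', ?_⟩, hnew⟩
      rw [hs, h0]; rfl
    · exact absurd rfl (h0 _ hr)
  · left
    simp only [hr] at hs hnew
    exact ⟨q', a', u ++ v.drop (c + 1), by rw [hs]; rfl, hnew⟩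

lemma outFrom_none [Fintype α] (C : BPDC α) (w : List α) : C.outFrom none w = [] := by
  induction w with
  | nil => rfl
  | cons b w ih => simp [BPDC.outFrom, BPDC.outAt, ih]

lemma lamStar_nil (δ : Q → Option α → Γ → Option (Q × List Γ)) (n : ℕ) (q : Q) :
    lamStar δ n (q, []) = (q, []) := by
  cases n <;> rfl

lemma outFrom_nil [Fintype α] (C : BPDC α) (q : C.Q) (w : List α) :
    C.outFrom (some (q, [])) w = [] := by
  cases w with
  | nil => rfl
  | cons b w => simp [BPDC.outFrom, BPDC.outAt, symStep, lamStar_nil, outFrom_none]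

lemma outFrom_eq [Fintype α] (C : BPDC α) (w : List α) :
    letI := C.fintypeΓ
    ∀ (q : C.Q) (a : C.Γ) (v : List C.Γ),
    C.outFrom (some (q, a :: v)) w =
      (newC C).outFrom (some ((q, a, ⟨[], by simp⟩), (enc v).map some ++ [none])) w := by
  letI := C.fintypeΓ
  induction w with
  | nil => intros; rfl
  | cons b w ih =>
    intro q a v
    have h1 : (newC C).outAt (some ((q, a, ⟨[], by simp⟩), (enc v).map some ++ [none])) b
        = C.ν q b a := by
      rcases enc v with _ | ⟨x, r⟩ <;> rfl
    simp only [BPDC.outFrom, h1, Option.bind_some]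
    congr 1
    have hδ := newδ_symStep C.δ C.c ((C.c + 1) * Fintype.card C.Γ) rfl b q a v
    rcases hδ with ⟨q', a', u, h2, h3⟩ | ⟨h2, h3⟩
    · rw [h2, ih]
      exact congrArg (fun o => (newC C).outFrom o w) h3.symm
    · have h4 : (newC C).outFrom (symStep (newC C).δ (newC C).c b
          ((q, a, ⟨[], by simp⟩), (enc v).map some ++ [none])) w = [] :=
        (congrArg (fun o => (newC C).outFrom o w) h3).trans (outFrom_none _ _)
      refine Eq.trans ?_ h4.symm
      rcases h2 with h2 | ⟨q', h2⟩
      · rw [h2, outFrom_none]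
      · rw [h2, outFrom_nil]

end ThreeStack

/-- For every bounded pushdown compressor `C` there is a
bounded pushdown compressor `C'` whose stack alphabet has exactly three
symbols (`{0, 1, z₀'}`) such that `C(w) = C'(w)` for every `w ∈ Σ*`. -/
theorem bpdc_three_stack_symbols {α : Type} [Fintype α]
    (hα : 2 ≤ Fintype.card α) (C : BPDC α) :
    ∃ C' : BPDC α, C'.numStackSymbols = 3 ∧ ∀ w : List α, C.output w = C'.output w := by
  exact ⟨ThreeStack.newC C, rfl, fun w => ThreeStack.outFrom_eq C w C.q0 C.z0 []⟩
end

section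
/- For every sequence S ∈ Σ^∞, the bounded pushdown dimension of S equals its bounded pushdown compression ratio: dim_BPD(S) = ρ_BPD(S). -/
namespace BPDProof

section Skeleton

variable {α Q Γ : Type}

/-- Lists of length at most `L`. -/
def Bnd (β : Type) (L : ℕ) : Type := {l : List β // l.length ≤ L}

instance (β : Type) [Finite β] (L : ℕ) : Finite (Bnd β L) :=
  (List.finite_length_le β L).to_subtype

/-- Truncation of a list to length `L`. -/
def trunc {β : Type} (L : ℕ) (l : List β) : Bnd β L := ⟨l.take L, by simp⟩

theorem trunc_val {β : Type} {L : ℕ} {l : List β} (h : l.length ≤ L) : (trunc L l).1 = l := by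
  simp [trunc, h]

/-- Extended run from a possibly undefined configuration. -/
def runO (δ : Q → Option α → Γ → Option (Q × List Γ)) (c : ℕ)
    (oc : Option (Q × List Γ)) (w : List α) : Option (Q × List Γ) :=
  w.foldl (fun o b => o.bind (symStep δ c b)) oc

theorem runO_append (δ : Q → Option α → Γ → Option (Q × List Γ)) (c : ℕ)
    (oc : Option (Q × List Γ)) (u w : List α) :
    runO δ c oc (u ++ w) = runO δ c (runO δ c oc u) w := by
  simp [runO]

theorem runO_cons (δ : Q → Option α → Γ → Option (Q × List Γ)) (c : ℕ)
    (oc : Option (Q × List Γ)) (b : α) (w : List α) :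
    runO δ c oc (b :: w) = runO δ c (oc.bind (symStep δ c b)) w := by
  simp [runO]

theorem runO_nil (δ : Q → Option α → Γ → Option (Q × List Γ)) (c : ℕ)
    (oc : Option (Q × List Γ)) : runO δ c oc [] = oc := rfl

/-- Configuration with a possibly dead state. -/
def oapp (oq : Option Q) (x : List Γ) : Option (Q × List Γ) := oq.map fun q => (q, x)

/-- Append `v` below the stack. -/
def below (v : List Γ) (p : Q × List Γ) : Q × List Γ := (p.1, p.2 ++ v)

theorem lamStep_below (δ : Q → Option α → Γ → Option (Q × List Γ)) (v : List Γ)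
    (p : Q × List Γ) (hp : 1 ≤ p.2.length) :
    lamStep δ (below v p) = (lamStep δ p).map (below v) ∧
      ∀ p', lamStep δ p = some p' → p.2.length ≤ p'.2.length + 1 := by
  obtain ⟨q, x⟩ := p
  cases x with
  | nil => simp at hp
  | cons a x =>
    simp only [below, lamStep, List.cons_append]
    constructor
    · cases δ q none a <;> simp [below]
    · intro p' h
      cases h2 : δ q none a with
      | none => simp [h2] at h
      | some r => 
        simp [h2] at h
        subst h
        simp

theorem lamStar_below (δ : Q → Option α → Γ → Option (Q × List Γ)) (v : List Γ) (n : ℕ) :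
    ∀ (p : Q × List Γ), n ≤ p.2.length →
    lamStar δ n (below v p) = below v (lamStar δ n p) ∧
      p.2.length ≤ (lamStar δ n p).2.length + n := by
  induction n with
  | zero => intro p _; simp [lamStar]
  | succ n ih =>
    intro p hp
    obtain ⟨h1, h2⟩ := lamStep_below δ v p (by omega)
    simp only [lamStar, h1]
    cases h3 : lamStep δ p with
    | none => simp
    | some p' =>
      have := h2 p' h3
      obtain ⟨h4, h5⟩ := ih p' (by omega)
      simp only [Option.map_some]
      exact ⟨h4, by omega⟩

theorem symStep_below (δ : Q → Option α → Γ → Option (Q × List Γ)) (c : ℕ) (b : α) (v : List Γ)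
    (p : Q × List Γ) (hp : c + 1 ≤ p.2.length) :
    symStep δ c b (below v p) = (symStep δ c b p).map (below v) ∧
      ∀ p', symStep δ c b p = some p' → p.2.length ≤ p'.2.length + (c + 1) := by
  obtain ⟨h1, h2⟩ := lamStar_below δ v c p (by omega)
  simp only [symStep, h1]
  rcases h3 : lamStar δ c p with ⟨q, x⟩
  rw [h3] at h2
  cases x with
  | nil => simp at h2; omega
  | cons a x =>
    simp only [below, List.cons_append]
    constructor
    · cases δ q (some b) a <;> simp [below]
    · intro p' h
      cases h4 : δ q (some b) a with
      | none => simp [h4] at h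
      | some r =>
        simp [h4] at h
        subst h
        simp at h2 ⊢
        omega

theorem runO_below (δ : Q → Option α → Γ → Option (Q × List Γ)) (c : ℕ) (v : List Γ)
    (u : List α) : ∀ (oc : Option (Q × List Γ)),
    (∀ p, oc = some p → (c + 1) * u.length ≤ p.2.length) →
    runO δ c (oc.map (below v)) u = (runO δ c oc u).map (below v) := by
  induction u with
  | nil => intro oc _; rfl
  | cons b u ih =>
    intro oc h
    rw [runO_cons, runO_cons]
    cases oc with
    | none => exact ih none (by simp)
    | some p =>
      have hp := h p rfl
      simp only [List.length_cons, Nat.mul_add, Nat.mul_one] at hp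
      obtain ⟨h1, h2⟩ := symStep_below δ c b v p (by omega)
      simp only [Option.map_some, Option.bind_some, h1]
      exact ih _ (fun p' h' => by have := h2 p' h'; omega)

/-- State space of the block-simulating skeleton machine. -/
abbrev SkQ (α Q Γ : Type) (L k : ℕ) : Type := Option Q × Bnd Γ L × Bnd α k

/-- Transition function of the block-simulating skeleton machine. -/
def skδ (δ : Q → Option α → Γ → Option (Q × List Γ)) (c L k : ℕ) :
    SkQ α Q Γ L k → Option α → Option Γ → Option (SkQ α Q Γ L k × List (Option Γ))
  | (oq, x, u), none, some g =>
    if u.1.length = 0 ∧ x.1.length < L then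
      some ((oq, trunc L (x.1 ++ [g]), trunc k []), []) else none
  | _, none, none => none
  | (oq, x, u), some b, a =>
    if u.1.length = 0 ∧ x.1.length < L ∧ a.isSome = true then none else
    if u.1.length + 1 < k then some ((oq, x, trunc k (u.1 ++ [b])), [a]) else
    match runO δ c (oapp oq x.1) (u.1 ++ [b]) with
    | none => some ((none, trunc L [], trunc k []), [a])
    | some (q', y) => some ((some q', trunc L [], trunc k []), y.map some ++ [a])

theorem skδ_det (δ : Q → Option α → Γ → Option (Q × List Γ)) (c L k : ℕ)
    (q : SkQ α Q Γ L k) (a : Option Γ) :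
    skδ δ c L k q none a = none ∨ ∀ b : α, skδ δ c L k q (some b) a = none := by
  obtain ⟨oq, x, u⟩ := q
  cases a with
  | none => left; rfl
  | some g =>
    by_cases h : u.1.length = 0 ∧ x.1.length < L
    · right; intro b; simp only [skδ]; rw [if_pos]; simpa using h
    · left; simp only [skδ]; rw [if_neg h]

theorem skδ_bottom (δ : Q → Option α → Γ → Option (Q × List Γ)) (c L k : ℕ)
    (q : SkQ α Q Γ L k) (b : Option α) :
    skδ δ c L k q b none = none ∨
      ∃ q' v, skδ δ c L k q b none = some (q', v ++ [none]) := by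
  obtain ⟨oq, x, u⟩ := q
  cases b with
  | none => left; rfl
  | some b =>
    right
    simp only [skδ]
    rw [if_neg (by simp)]
    split_ifs with h
    · exact ⟨_, [], rfl⟩
    · split
      · exact ⟨_, [], rfl⟩
      · exact ⟨_, _, rfl⟩

theorem skδ_lam (δ : Q → Option α → Γ → Option (Q × List Γ)) (c L k : ℕ) (n : ℕ) :
    ∀ (oq : Option Q) (x : Bnd Γ L) (u : Bnd α k) (st : List (Option Γ)),
    L < x.1.length + n → lamIter (skδ δ c L k) n ((oq, x, u), st) = none := by
  induction n with
  | zero => intro oq x u st h; have := x.2; omega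
  | succ n ih =>
    intro oq x u st h
    simp only [lamIter]
    cases st with
    | nil => rfl
    | cons a st =>
      cases a with
      | none => rfl
      | some g =>
        simp only [lamStep, skδ]
        split_ifs with h2
        · simp only [Option.map_some, Option.bind_some]
          apply ih
          rw [trunc_val (by simp; omega)]
          simp; omega
        · rfl

theorem skδ_lamBound (δ : Q → Option α → Γ → Option (Q × List Γ)) (c L k : ℕ)
    (cfg : SkQ α Q Γ L k × List (Option Γ)) :
    lamIter (skδ δ c L k) (L + 1) cfg = none := by
  obtain ⟨⟨oq, x, u⟩, st⟩ := cfg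
  exact skδ_lam δ c L k _ _ _ _ _ (by omega)

/-- Standard skeleton configuration. -/
def mid (L k : ℕ) (oq : Option Q) (x : List Γ) (u : List α) (v : List Γ) :
    SkQ α Q Γ L k × List (Option Γ) :=
  ((oq, trunc L x, trunc k u), v.map some ++ [none])

theorem lamStep_mid_load (δ : Q → Option α → Γ → Option (Q × List Γ)) (c L k : ℕ)
    (oq : Option Q) (x : List Γ) (g : Γ) (v : List Γ) (hx : x.length < L) :
    lamStep (skδ δ c L k) (mid L k oq x [] (g :: v)) = some (mid L k oq (x ++ [g]) [] v) := by
  simp only [lamStep, mid, skδ, List.map_cons, List.cons_append]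
  rw [if_pos (by rw [trunc_val hx.le, trunc_val (by simp)]; simp [hx])]
  simp [trunc_val hx.le]

theorem lamStep_mid_none (δ : Q → Option α → Γ → Option (Q × List Γ)) (c L k : ℕ)
    (oq : Option Q) (x : List Γ) (u : List α) (v : List Γ) (hx : x.length ≤ L) (hu : u.length ≤ k)
    (h : u ≠ [] ∨ x.length = L ∨ v = []) :
    lamStep (skδ δ c L k) (mid L k oq x u v) = none := by
  cases v with
  | nil => rfl
  | cons g v =>
    simp only [lamStep, mid, skδ, List.map_cons, List.cons_append]
    rw [if_neg]
    · rfl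
    · rw [trunc_val hx, trunc_val hu]
      rintro ⟨h1, h2⟩
      rcases h with h | h | h
      · exact h (List.length_eq_zero_iff.1 h1)
      · omega
      · simp at h

theorem lamStar_mid (δ : Q → Option α → Γ → Option (Q × List Γ)) (c L k : ℕ)
    (oq : Option Q) (n : ℕ) : ∀ (x v : List Γ), x.length ≤ L → L ≤ x.length + n →
    lamStar (skδ δ c L k) n (mid L k oq x [] v) =
      mid L k oq ((x ++ v).take L) [] ((x ++ v).drop L) := by
  induction n with
  | zero =>
    intro x v h1 h2
    have : x.length = L := by omega
    subst this
    simp [lamStar]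
  | succ n ih =>
    intro x v h1 h2
    simp only [lamStar]
    by_cases hx : x.length = L
    · rw [lamStep_mid_none _ _ _ _ _ _ _ _ h1 (by simp) (Or.inr (Or.inl hx))]
      subst hx
      simp
    · cases v with
      | nil =>
        rw [lamStep_mid_none _ _ _ _ _ _ _ _ h1 (by simp) (Or.inr (Or.inr rfl))]
        simp [List.take_of_length_le h1, List.drop_of_length_le h1]
      | cons g v =>
        rw [lamStep_mid_load _ _ _ _ _ _ _ _ (by omega)]
        simp only
        rw [ih _ _ (by simp; omega) (by simp; omega)]
        simp

theorem lamStar_mid_ne (δ : Q → Option α → Γ → Option (Q × List Γ)) (c L k : ℕ)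
    (oq : Option Q) (n : ℕ) (x : List Γ) (u : List α) (v : List Γ) (hx : x.length ≤ L)
    (hu : u.length ≤ k) (h : u ≠ []) :
    lamStar (skδ δ c L k) n (mid L k oq x u v) = mid L k oq x u v := by
  cases n with
  | zero => rfl
  | succ n => simp only [lamStar]; rw [lamStep_mid_none _ _ _ _ _ _ _ _ hx hu (Or.inl h)]

theorem symStep_eq {Q' Γ' : Type} (δ : Q' → Option α → Γ' → Option (Q' × List Γ')) (c : ℕ) (b : α)
    (p : Q' × List Γ') (q : Q') (a : Γ') (v : List Γ') (h : lamStar δ c p = (q, a :: v)) :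
    symStep δ c b p = (δ q (some b) a).map fun p => (p.1, p.2 ++ v) := by
  simp only [symStep, h]

/-- Reading a symbol before the end of the block. -/
theorem symStep_mid_aux (δ : Q → Option α → Γ → Option (Q × List Γ)) (c L k : ℕ)
    (oq : Option Q) (x : List Γ) (u : List α) (v : List Γ) (b : α)
    (p : SkQ α Q Γ L k × List (Option Γ))
    (hp : lamStar (skδ δ c L k) L p = mid L k oq x u v) (hx : x.length ≤ L)
    (hu : u.length + 1 < k) (h : u ≠ [] ∨ x.length = L ∨ v = []) :
    symStep (skδ δ c L k) L b p = some (mid L k oq x (u ++ [b]) v) := by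
  cases v with
  | nil =>
    rw [symStep_eq _ _ _ _ _ _ _ hp]
    simp only [skδ]
    rw [if_neg (by simp), if_pos (by rw [trunc_val (by omega)]; exact hu)]
    simp [mid, trunc_val (show u.length ≤ k by omega)]
  | cons g v =>
    rw [symStep_eq _ _ _ _ _ _ _ hp]
    simp only [skδ]
    rw [if_neg, if_pos (by rw [trunc_val (by omega)]; exact hu)]
    · simp [mid, trunc_val (show u.length ≤ k by omega)]
    · rw [trunc_val hx, trunc_val (by omega)]
      rintro ⟨h1, h2, -⟩
      rcases h with h | h | h
      · exact h (List.length_eq_zero_iff.1 h1)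
      · omega
      · simp at h

/-- The skeleton configuration after a complete block. -/
def blockEnd (L k : ℕ) (v : List Γ) : Option (Q × List Γ) → SkQ α Q Γ L k × List (Option Γ)
  | none => mid L k none [] [] v
  | some (q, y) => mid L k (some q) [] [] (y ++ v)

theorem symStep_mid_last (δ : Q → Option α → Γ → Option (Q × List Γ)) (c L k : ℕ)
    (oq : Option Q) (x : List Γ) (u : List α) (v : List Γ) (b : α) (hx : x.length ≤ L)
    (hu : u.length + 1 = k) (h : u ≠ []) :
    symStep (skδ δ c L k) L b (mid L k oq x u v) =
      some (blockEnd L k v (runO δ c (oapp oq x) (u ++ [b]))) := by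
  have hp := lamStar_mid_ne δ c L k oq L x u v hx (by omega) h
  have h0 : u.length ≠ 0 := fun h' => h (List.length_eq_zero_iff.1 h')
  cases v with
  | nil =>
    rw [symStep_eq _ _ _ _ _ _ _ hp]
    simp only [skδ]
    rw [trunc_val hx, trunc_val (show u.length ≤ k by omega)]
    rw [if_neg (by simp), if_neg (by omega)]
    rcases runO δ c (oapp oq x) (u ++ [b]) with _ | ⟨q, y⟩ <;> simp [blockEnd, mid]
  | cons g v =>
    rw [symStep_eq _ _ _ _ _ _ _ hp]
    simp only [skδ]
    rw [trunc_val hx, trunc_val (show u.length ≤ k by omega)]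
    rw [if_neg (by tauto), if_neg (by omega)]
    rcases runO δ c (oapp oq x) (u ++ [b]) with _ | ⟨q, y⟩ <;> simp [blockEnd, mid]

/-- Run on a proper nonempty part of a block. -/
theorem run_partial (δ : Q → Option α → Γ → Option (Q × List Γ)) (c L k : ℕ)
    (oq : Option Q) (x v : List Γ) (hx : x.length ≤ L) (w : List α) (hw0 : w ≠ [])
    (hw : w.length < k) :
    runO (skδ δ c L k) L (some (mid L k oq x [] v)) w =
      some (mid L k oq ((x ++ v).take L) w ((x ++ v).drop L)) := by
  induction w using List.reverseRecOn with
  | nil => exact absurd rfl hw0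
  | append_singleton w b ih =>
    rw [runO_append]
    simp only [List.length_append, List.length_singleton] at hw
    by_cases h : w = []
    · subst h
      rw [runO_nil, runO_cons, runO_nil, Option.bind_some]
      rw [symStep_mid_aux δ c L k oq _ [] _ b _ (lamStar_mid δ c L k oq L x v hx (by omega))
        (by simp) hw]
      right
      by_cases h : L ≤ (x ++ v).length
      · left; simpa using h
      · right; apply List.drop_of_length_le; omega
    · rw [ih h (by omega), runO_cons, runO_nil, Option.bind_some]
      rw [symStep_mid_aux δ c L k oq _ w _ b _ (lamStar_mid_ne δ c L k oq L _ w _ (by simp)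
        (by omega) h) (by simp) hw (Or.inl h)]

/-- Run on a complete block. -/
theorem run_block (δ : Q → Option α → Γ → Option (Q × List Γ)) (c L k : ℕ) (hk : 2 ≤ k)
    (oq : Option Q) (x v : List Γ) (hx : x.length ≤ L) (w : List α)
    (hw : w.length = k) :
    runO (skδ δ c L k) L (some (mid L k oq x [] v)) w =
      some (blockEnd L k ((x ++ v).drop L) (runO δ c (oapp oq ((x ++ v).take L)) w)) := by
  rcases List.eq_nil_or_concat' w with rfl | ⟨w, b, rfl⟩
  · simp at hw; omega
  · simp only [List.length_append, List.length_singleton] at hw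
    have h : w ≠ [] := by rintro rfl; simp at hw; omega
    rw [runO_append, run_partial δ c L k oq x v hx w h (by omega), runO_cons, runO_nil,
      Option.bind_some, symStep_mid_last δ c L k oq _ w _ b (by simp) hw h]

/-- Simulation relation. -/
def Rel (L k : ℕ) (oc : Option (Q × List Γ)) (s : SkQ α Q Γ L k × List (Option Γ)) : Prop :=
  ∃ oq x v, x.length ≤ L ∧ s = mid L k oq x [] v ∧ oc = oapp oq (x ++ v)

theorem oapp_split (L : ℕ) (oq : Option Q) (z : List Γ) :
    oapp oq z = (oapp oq (z.take L)).map (below (z.drop L)) := by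
  cases oq <;> simp [oapp, below]

theorem rel_block (δ : Q → Option α → Γ → Option (Q × List Γ)) (c L k : ℕ)
    (hL : (c + 1) * k ≤ L)
    (oq : Option Q) (z : List Γ) (w : List α) (hw : w.length = k) :
    Rel L k (runO δ c (oapp oq z) w)
      ((blockEnd L k (z.drop L) (runO δ c (oapp oq (z.take L)) w)) :
        SkQ α Q Γ L k × List (Option Γ)) := by
  have key : runO δ c (oapp oq z) w = (runO δ c (oapp oq (z.take L)) w).map (below (z.drop L)) := by
    by_cases h : L ≤ z.length
    · rw [oapp_split L oq z]
      apply runO_below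
      rintro p hp
      cases oq with
      | none => simp [oapp] at hp
      | some q => 
        simp [oapp] at hp
        subst hp
        simp [hw]
        exact ⟨hL, hL.trans h⟩
    · rw [List.take_of_length_le (by omega), List.drop_of_length_le (by omega)]
      have : (below ([] : List Γ) : Q × List Γ → _) = id := by funext p; simp [below]
      rw [this]; simp
  rw [key]
  rcases runO δ c (oapp oq (z.take L)) w with _ | ⟨q, y⟩
  · exact ⟨none, [], z.drop L, by simp, rfl, rfl⟩
  · exact ⟨some q, [], y ++ z.drop L, by simp, rfl, rfl⟩

end Skeleton

section Sums

variable {α : Type} [Fintype α]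

theorem sum_ofFn_succ {R : Type} [AddCommMonoid R] (j : ℕ) (f : List α → R) :
    ∑ v : Fin (j + 1) → α, f (List.ofFn v) = ∑ b : α, ∑ v : Fin j → α, f (b :: List.ofFn v) := by
  rw [← Fintype.sum_prod_type' (f := fun (b : α) (v : Fin j → α) => f (b :: List.ofFn v))]
  refine (Fintype.sum_equiv (Fin.consEquiv (fun _ => α)) _ _ ?_).symm
  rintro ⟨b, v⟩
  simp [Fin.consEquiv, List.ofFn_cons]

/-- Total weight of the extensions of `u` by `j` symbols. -/
def W (f : List α → ℚ) : ℕ → List α → ℚ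
  | 0, u => f u
  | j + 1, u => ∑ b : α, W f j (u ++ [b])

theorem W_eq_sum (f : List α → ℚ) (j : ℕ) : ∀ u,
    W f j u = ∑ v : Fin j → α, f (u ++ List.ofFn v) := by
  induction j with
  | zero => intro u; simp [W]
  | succ j ih =>
    intro u
    rw [sum_ofFn_succ j (fun v => f (u ++ v))]
    simp only [W, ih]
    simp

theorem W_pos [Nonempty α] (f : List α → ℚ) (hf : ∀ u, 0 < f u) (j : ℕ) : ∀ u, 0 < W f j u := by
  induction j with
  | zero => intro u; exact hf u
  | succ j ih => intro u; exact Finset.sum_pos (fun b _ => ih _) Finset.univ_nonempty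

theorem exists_ofFn (k : ℕ) (u : List α) (hu : u.length = k) :
    ∃ f : Fin k → α, List.ofFn f = u := by
  subst hu
  exact ⟨u.get, List.ofFn_get u⟩

/-- Kraft-type bound. -/
theorem kraft {T : Type} [Fintype T] [DecidableEq T] [Nonempty α] (j N : ℕ) (u : List α)
    (out : List α → List α)
    (st : List α → T)
    (hinj : ∀ w w', out w = out w' → st w = st w' → w = w')
    (hN : ∀ w, w.length = u.length + j → (out w).length ≤ N) :
    W (fun w => ((Fintype.card α : ℚ) ^ (out w).length)⁻¹) j u ≤ (Fintype.card T * (N + 1) : ℕ) := by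
  classical
  set A := Fintype.card α with hA
  have hA0 : 0 < A := Fintype.card_pos
  rw [W_eq_sum]
  let g : (Fin j → α) → T × Fin (N + 1) := fun v =>
    (st (u ++ List.ofFn v), ⟨(out (u ++ List.ofFn v)).length, Nat.lt_succ_of_le (hN _ (by simp))⟩)
  rw [← Finset.sum_fiberwise Finset.univ g]
  have : ∀ t : T × Fin (N + 1), ∑ v : Fin j → α with g v = t,
      ((A : ℚ) ^ (out (u ++ List.ofFn v)).length)⁻¹ ≤ 1 := by
    rintro ⟨t, l⟩
    have h1 : ∀ v ∈ Finset.univ.filter (fun v => g v = (t, l)),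
        ((A : ℚ) ^ (out (u ++ List.ofFn v)).length)⁻¹ = ((A : ℚ) ^ (l : ℕ))⁻¹ := by
      intro v hv
      simp only [Finset.mem_filter, Finset.mem_univ, true_and, g, Prod.mk.injEq] at hv
      rw [← hv.2]
    rw [Finset.sum_congr rfl h1, Finset.sum_const, nsmul_eq_mul]
    have h2 : (Finset.univ.filter (fun v => g v = (t, l))).card ≤ A ^ (l : ℕ) := by
      have : A ^ (l : ℕ) = (Finset.univ : Finset (Fin (l : ℕ) → α)).card := by simp [hA]
      rw [this]
      let φ : (Fin j → α) → (Fin (l : ℕ) → α) := fun v =>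
        if h : (out (u ++ List.ofFn v)).length = l then
          fun i => (out (u ++ List.ofFn v)).get (i.cast h.symm) else fun _ => Classical.arbitrary α
      apply Finset.card_le_card_of_injOn φ
      · intro v _; simp
      · intro v hv v' hv' he
        simp only [Finset.coe_filter, Finset.mem_univ, true_and, Set.mem_setOf_eq, g,
          Prod.mk.injEq] at hv hv'
        have hl : (out (u ++ List.ofFn v)).length = l := by rw [← hv.2]
        have hl' : (out (u ++ List.ofFn v')).length = l := by rw [← hv'.2]
        simp only [φ, dif_pos hl, dif_pos hl'] at he
        have ho : out (u ++ List.ofFn v) = out (u ++ List.ofFn v') := by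
          apply List.ext_get (by rw [hl, hl'])
          intro n h1 h2
          exact congrFun he ⟨n, by omega⟩
        have := hinj _ _ ho (hv.1.trans hv'.1.symm)
        exact List.ofFn_injective (List.append_cancel_left this)
    have h3 : (0 : ℚ) < (A : ℚ) ^ (l : ℕ) := by positivity
    rw [← div_eq_mul_inv, div_le_one h3]
    exact_mod_cast h2
  refine (Finset.sum_le_sum (fun t _ => this t)).trans ?_
  simp

/-- Existence of a good prefix code. -/
theorem exists_code [Nonempty α] (k h : ℕ) (hk : k + 1 ≤ Fintype.card α ^ h) (h1 : 1 ≤ h)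
    (M : List α → ℝ) (M0 : ∀ u, 0 ≤ M u)
    (hsum : ∑ f : Fin k → α, M (List.ofFn f) = (Fintype.card α : ℝ) ^ k) :
    ∃ code : List α → List α,
      (∀ u u', u.length = k → u'.length = k → ∀ r r', code u ++ r = code u' ++ r' → u = u') ∧
      (∀ u, u.length = k → code u ≠ []) ∧
      ∀ u, u.length = k → M u * (Fintype.card α : ℝ) ^ (code u).length ≤
        (Fintype.card α : ℝ) ^ (k + 1 + h) := by
  classical
  set A := Fintype.card α with hA
  have hA0 : 0 < A := Fintype.card_pos
  have hA0' : (0 : ℝ) < A := by exact_mod_cast hA0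
  have hA1 : (1 : ℝ) ≤ A := by exact_mod_cast hA0
  have hex : ∀ f : Fin k → α, ∃ l, l = k ∨ (A : ℝ) ^ k ≤ M (List.ofFn f) * (A : ℝ) ^ l :=
    fun f => ⟨k, Or.inl rfl⟩
  let ℓ : (Fin k → α) → ℕ := fun f => Nat.find (hex f)
  have hℓk : ∀ f, ℓ f ≤ k := fun f => Nat.find_min' (hex f) (Or.inl rfl)
  have hℓspec : ∀ f, ℓ f = k ∨ (A : ℝ) ^ k ≤ M (List.ofFn f) * (A : ℝ) ^ ℓ f :=
    fun f => Nat.find_spec (hex f)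
  have hle : ∀ f : Fin k → α, M (List.ofFn f) ≤ (A : ℝ) ^ k := by
    intro f
    rw [← hsum]
    exact Finset.single_le_sum (f := fun f : Fin k → α => M (List.ofFn f))
      (fun i _ => M0 _) (Finset.mem_univ f)
  have hℓM : ∀ f, M (List.ofFn f) * (A : ℝ) ^ ℓ f ≤ (A : ℝ) ^ (k + 1) := by
    intro f
    rcases hl : ℓ f with _ | l
    · rw [pow_zero, mul_one]
      exact (hle f).trans (pow_le_pow_right₀ hA1 (by omega))
    · have := Nat.find_min (hex f) (show l < Nat.find (hex f) by
        change l < ℓ f; omega)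
      push Not at this
      rw [pow_succ, pow_succ, ← mul_assoc]
      exact mul_le_mul_of_nonneg_right this.2.le hA0'.le
  have hcard : ∀ l, Fintype.card {f : Fin k → α // ℓ f = l} ≤ Fintype.card (Fin l → α) := by
    intro l
    have hc : Fintype.card (Fin l → α) = A ^ l := by simp [hA]
    rw [hc]
    by_cases hl : l = k
    · subst hl
      refine (Fintype.card_subtype_le _).trans ?_
      simp [hA]
    · rw [Fintype.card_subtype]
      have h3 : ((Finset.univ.filter (fun f => ℓ f = l)).card : ℝ) * (A : ℝ) ^ k
          ≤ (A : ℝ) ^ k * (A : ℝ) ^ l := by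
        rw [← nsmul_eq_mul, ← Finset.sum_const]
        calc _ ≤ ∑ f ∈ Finset.univ.filter (fun f => ℓ f = l), M (List.ofFn f) * (A : ℝ) ^ l := by
              apply Finset.sum_le_sum
              intro f hf
              simp only [Finset.mem_filter, Finset.mem_univ, true_and] at hf
              rcases hℓspec f with h' | h'
              · omega
              · rwa [hf] at h'
          _ ≤ ∑ f : Fin k → α, M (List.ofFn f) * (A : ℝ) ^ l := by
              apply Finset.sum_le_sum_of_subset_of_nonneg (Finset.subset_univ _)
              intro f _ _
              have := M0 (List.ofFn f)
              positivity
          _ = _ := by rw [← Finset.sum_mul, hsum]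
      have h4 : (0 : ℝ) < (A : ℝ) ^ k := by positivity
      rw [mul_comm] at h3
      have h5 := le_of_mul_le_mul_left h3 h4
      exact_mod_cast h5
  have hI : ∀ l, Nonempty ({f : Fin k → α // ℓ f = l} ↪ (Fin l → α)) := fun l =>
    Function.Embedding.nonempty_of_card_le (hcard l)
  have hE : Nonempty (Fin (k + 1) ↪ (Fin h → α)) :=
    Function.Embedding.nonempty_of_card_le (by simpa [hA] using hk)
  let I : ∀ l, {f : Fin k → α // ℓ f = l} ↪ (Fin l → α) := fun l => (hI l).some
  let E : Fin (k + 1) ↪ (Fin h → α) := hE.some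
  let codeF : (Fin k → α) → List α := fun f =>
    List.ofFn (E ⟨ℓ f, Nat.lt_succ_of_le (hℓk f)⟩) ++ List.ofFn (I (ℓ f) ⟨f, rfl⟩)
  have hlen : ∀ f, (codeF f).length = h + ℓ f := fun f => by simp [codeF]
  have hpre : ∀ f f' r r', codeF f ++ r = codeF f' ++ r' → f = f' := by
    intro f f' r r' he
    simp only [codeF, List.append_assoc] at he
    obtain ⟨e1, e2⟩ := List.append_inj he (by simp)
    have e3 := E.injective (List.ofFn_injective e1)
    have e4 : ℓ f = ℓ f' := by simpa using e3
    obtain ⟨e5, -⟩ := List.append_inj e2 (by simp [e4])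
    have gen : ∀ l (hl : ℓ f' = l), List.ofFn (I (ℓ f') ⟨f', rfl⟩) = List.ofFn (I l ⟨f', hl⟩) := by
      intro l hl; subst hl; rfl
    rw [gen (ℓ f) e4.symm] at e5
    have e6 := (I (ℓ f)).injective (List.ofFn_injective e5)
    exact congrArg Subtype.val e6
  let code : List α → List α := fun u =>
    if hu : ∃ f : Fin k → α, List.ofFn f = u then codeF hu.choose else []
  have hcode : ∀ f : Fin k → α, code (List.ofFn f) = codeF f := by
    intro f
    have hu : ∃ f' : Fin k → α, List.ofFn f' = List.ofFn f := ⟨f, rfl⟩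
    simp only [code, dif_pos hu]
    rw [List.ofFn_injective hu.choose_spec]
  refine ⟨code, ?_, ?_, ?_⟩
  · intro u u' hu hu' r r' he
    obtain ⟨f, rfl⟩ := exists_ofFn k u hu
    obtain ⟨f', rfl⟩ := exists_ofFn k u' hu'
    rw [hcode, hcode] at he
    rw [hpre f f' r r' he]
  · intro u hu he
    obtain ⟨f, rfl⟩ := exists_ofFn k u hu
    rw [hcode] at he
    have := hlen f
    rw [he] at this
    simp at this
    omega
  · intro u hu
    obtain ⟨f, rfl⟩ := exists_ofFn k u hu
    rw [hcode, hlen, pow_add, pow_add _ (k + 1), mul_left_comm, mul_comm _ ((A : ℝ) ^ h)]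
    exact mul_le_mul_of_nonneg_left (hℓM f) (by positivity)

end Sums

section Machines

variable {α : Type} [Fintype α]

theorem martFrom_append (G : BPDG α) (u w : List α) : ∀ oc,
    G.martFrom oc (u ++ w) = G.martFrom oc u * G.martFrom (runO G.δ G.c oc u) w := by
  induction u with
  | nil => intro oc; simp [BPDG.martFrom, runO_nil]
  | cons b u ih =>
    intro oc
    simp only [List.cons_append, BPDG.martFrom, ih, runO_cons, mul_assoc]

theorem outFrom_append (C : BPDC α) (u w : List α) : ∀ oc,
    C.outFrom oc (u ++ w) = C.outFrom oc u ++ C.outFrom (runO C.δ C.c oc u) w := by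
  induction u with
  | nil => intro oc; simp [BPDC.outFrom, runO_nil]
  | cons b u ih =>
    intro oc
    simp only [List.cons_append, BPDC.outFrom, ih, runO_cons, List.append_assoc]

theorem betAt_nonneg (G : BPDG α) (oc) (b : α) : 0 ≤ G.betAt oc b := by
  unfold BPDG.betAt
  split
  · exact_mod_cast G.β_nonneg _ _ _
  · positivity

theorem betAt_sum [Nonempty α] (G : BPDG α) (oc) : ∑ b, G.betAt oc b = 1 := by
  rcases oc with _ | ⟨q, _ | ⟨a, v⟩⟩
  · simp [BPDG.betAt]
  · simp [BPDG.betAt]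
  · simp only [BPDG.betAt]
    exact_mod_cast G.β_sum q a

theorem betAt_le_one [Nonempty α] (G : BPDG α) (oc) (b : α) : G.betAt oc b ≤ 1 := by
  rw [← betAt_sum G oc]
  exact Finset.single_le_sum (fun i _ => betAt_nonneg G oc i) (Finset.mem_univ b)

theorem martFrom_nonneg (G : BPDG α) (u : List α) : ∀ oc, 0 ≤ G.martFrom oc u := by
  induction u with
  | nil => intro oc; simp [BPDG.martFrom]
  | cons b u ih =>
    intro oc
    simp only [BPDG.martFrom]
    exact mul_nonneg (mul_nonneg (by positivity) (betAt_nonneg _ _ _)) (ih _)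

theorem martFrom_le [Nonempty α] (G : BPDG α) (u : List α) : ∀ oc,
    G.martFrom oc u ≤ (Fintype.card α : ℝ) ^ u.length := by
  induction u with
  | nil => intro oc; simp [BPDG.martFrom]
  | cons b u ih =>
    intro oc
    simp only [BPDG.martFrom, List.length_cons, pow_succ']
    apply mul_le_mul _ (ih _) (martFrom_nonneg _ _ _) (by positivity)
    exact mul_le_of_le_one_right (by positivity) (betAt_le_one _ _ _)

theorem martFrom_sum [Nonempty α] (G : BPDG α) (k : ℕ) : ∀ oc,
    ∑ f : Fin k → α, G.martFrom oc (List.ofFn f) = (Fintype.card α : ℝ) ^ k := by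
  induction k with
  | zero => intro oc; simp [BPDG.martFrom]
  | succ k ih =>
    intro oc
    rw [sum_ofFn_succ k (G.martFrom oc)]
    simp only [BPDG.martFrom, ← Finset.mul_sum, ih]
    rw [← Finset.sum_mul, ← Finset.mul_sum, betAt_sum, pow_succ]
    ring

theorem martFrom_below (G : BPDG α) (v : List G.Γ) (u : List α) :
    ∀ (oc : Option (G.Q × List G.Γ)),
    (∀ p, oc = some p → (G.c + 1) * u.length ≤ p.2.length) →
    G.martFrom (oc.map (below v)) u = G.martFrom oc u := by
  induction u with
  | nil => intro oc _; rfl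
  | cons b u ih =>
    intro oc h
    simp only [BPDG.martFrom]
    cases oc with
    | none => rfl
    | some p =>
      have hp := h p rfl
      simp only [List.length_cons, Nat.mul_add, Nat.mul_one] at hp
      obtain ⟨h1, h2⟩ := symStep_below G.δ G.c b v p (by omega)
      simp only [Option.map_some, Option.bind_some, h1]
      rw [ih _ (fun p' h' => by have := h2 p' h'; omega)]
      congr 2
      obtain ⟨q, x⟩ := p
      cases x with
      | nil => simp at hp
      | cons a x => simp [below, BPDG.betAt]

theorem outFrom_below (C : BPDC α) (v : List C.Γ) (u : List α) :
    ∀ (oc : Option (C.Q × List C.Γ)),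
    (∀ p, oc = some p → (C.c + 1) * u.length ≤ p.2.length) →
    C.outFrom (oc.map (below v)) u = C.outFrom oc u := by
  induction u with
  | nil => intro oc _; rfl
  | cons b u ih =>
    intro oc h
    simp only [BPDC.outFrom]
    cases oc with
    | none => rfl
    | some p =>
      have hp := h p rfl
      simp only [List.length_cons, Nat.mul_add, Nat.mul_one] at hp
      obtain ⟨h1, h2⟩ := symStep_below C.δ C.c b v p (by omega)
      simp only [Option.map_some, Option.bind_some, h1]
      rw [ih _ (fun p' h' => by have := h2 p' h'; omega)]
      congr 1
      obtain ⟨q, x⟩ := p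
      cases x with
      | nil => simp at hp
      | cons a x => simp [below, BPDC.outAt]

theorem oapp_len {Q Γ : Type} (L n : ℕ) (oq : Option Q) (z : List Γ) (hn : n ≤ L)
    (hz : L ≤ z.length) : ∀ p, oapp oq (z.take L) = some p → n ≤ p.2.length := by
  intro p hp
  cases oq with
  | none => simp [oapp] at hp
  | some q =>
    simp [oapp] at hp
    subst hp
    simp
    omega

theorem martFrom_take (G : BPDG α) (L : ℕ) (oq : Option G.Q) (z : List G.Γ) (u : List α)
    (hu : (G.c + 1) * u.length ≤ L) :
    G.martFrom (oapp oq z) u = G.martFrom (oapp oq (z.take L)) u := by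
  by_cases h : L ≤ z.length
  · rw [oapp_split L oq z]
    exact martFrom_below G _ u _ (oapp_len L _ oq z hu h)
  · rw [List.take_of_length_le (by omega)]

theorem outFrom_take (C : BPDC α) (L : ℕ) (oq : Option C.Q) (z : List C.Γ) (u : List α)
    (hu : (C.c + 1) * u.length ≤ L) :
    C.outFrom (oapp oq z) u = C.outFrom (oapp oq (z.take L)) u := by
  by_cases h : L ≤ z.length
  · rw [oapp_split L oq z]
    exact outFrom_below C _ u _ (oapp_len L _ oq z hu h)
  · rw [List.take_of_length_le (by omega)]

theorem outAt_le (C : BPDC α) (oc) (b : α) : (C.outAt oc b).length ≤ C.maxOut := by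
  rcases oc with _ | ⟨q, _ | ⟨a, v⟩⟩
  · simp [BPDC.outAt]
  · simp [BPDC.outAt]
  · letI := C.fintypeQ
    letI := C.fintypeΓ
    exact Finset.le_sup (f := fun p : C.Q × α × C.Γ => (C.ν p.1 p.2.1 p.2.2).length)
      (Finset.mem_univ (q, b, a))

theorem outFrom_le (C : BPDC α) (u : List α) : ∀ oc,
    (C.outFrom oc u).length ≤ u.length * C.maxOut := by
  induction u with
  | nil => intro oc; simp [BPDC.outFrom]
  | cons b u ih =>
    intro oc
    simp only [BPDC.outFrom, List.length_append, List.length_cons, Nat.add_mul, Nat.one_mul]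
    have := outAt_le C oc b
    have := ih (oc.bind (symStep C.δ C.c b))
    omega

end Machines

section Compress

variable {α : Type} [Fintype α]

/-- The block compressor built from a gambler. -/
noncomputable def comp (G : BPDG α) (L k : ℕ)
    (code : Option (G.Q × List G.Γ) → List α → List α) : BPDC α where
  Q := SkQ α G.Q G.Γ L k
  Γ := Option G.Γ
  fintypeQ := by
    haveI := G.fintypeQ
    haveI := G.fintypeΓ
    exact Fintype.ofFinite _
  fintypeΓ := by
    haveI := G.fintypeΓ
    exact inferInstance
  δ := skδ G.δ G.c L k
  ν := fun s b _ => if s.2.2.1.length + 1 = k then code (oapp s.1 s.2.1.1) (s.2.2.1 ++ [b]) else []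
  q0 := (some G.q0, trunc L [G.z0], trunc k [])
  z0 := none
  c := L
  det := skδ_det G.δ G.c L k
  bottom := skδ_bottom G.δ G.c L k
  lamBound := skδ_lamBound G.δ G.c L k

variable (G : BPDG α) (L k : ℕ) (code : Option (G.Q × List G.Γ) → List α → List α)

theorem comp_outAt (oq : Option G.Q) (x : List G.Γ) (u : List α) (v : List G.Γ) (b : α)
    (hx : x.length ≤ L) (hu : u.length ≤ k) :
    (comp G L k code).outAt (some (mid L k oq x u v)) b =
      if u.length + 1 = k then code (oapp oq x) (u ++ [b]) else [] := by
  have h1 := trunc_val hx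
  have h2 := trunc_val hu
  cases v <;> simp [BPDC.outAt, mid, comp, h1, h2]

theorem comp_partial (oq : Option G.Q) (x v : List G.Γ) (hx : x.length ≤ L) (w : List α)
    (hw : w.length < k) :
    (comp G L k code).outFrom (some (mid L k oq x [] v)) w = [] := by
  induction w using List.reverseRecOn with
  | nil => rfl
  | append_singleton w b ih =>
    simp only [List.length_append, List.length_singleton] at hw
    rw [outFrom_append, ih (by omega)]
    simp only [BPDC.outFrom, List.nil_append, List.append_nil]
    by_cases h : w = []
    · subst h
      rw [runO_nil, comp_outAt G L k code oq x [] v b hx (by simp), if_neg (by omega)]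
    · have := run_partial G.δ G.c L k oq x v hx w h (by omega)
      refine (congrArg (fun o => (comp G L k code).outAt o b) this).trans ?_
      refine (comp_outAt G L k code oq _ w _ b (by simp) (by omega)).trans ?_
      rw [if_neg (by omega)]

theorem comp_block (hk : 2 ≤ k) (oq : Option G.Q) (x v : List G.Γ) (hx : x.length ≤ L) (w : List α)
    (hw : w.length = k) :
    (comp G L k code).outFrom (some (mid L k oq x [] v)) w =
      code (oapp oq ((x ++ v).take L)) w := by
  rcases List.eq_nil_or_concat' w with rfl | ⟨w, b, rfl⟩
  · simp at hw; omega
  · simp only [List.length_append, List.length_singleton] at hw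
    have h : w ≠ [] := by rintro rfl; simp at hw; omega
    rw [outFrom_append, comp_partial G L k code oq x v hx w (by omega)]
    simp only [BPDC.outFrom, List.nil_append, List.append_nil]
    have := run_partial G.δ G.c L k oq x v hx w h (by omega)
    refine (congrArg (fun o => (comp G L k code).outAt o b) this).trans ?_
    refine (comp_outAt G L k code oq _ w _ b (by simp) (by omega)).trans ?_
    rw [if_pos hw]

theorem blockEnd_mid {Q Γ : Type} (L k : ℕ) (v : List Γ) (o : Option (Q × List Γ)) :
    ∃ oq v', (blockEnd L k v o : SkQ α Q Γ L k × List (Option Γ)) = mid L k oq [] [] v' := by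
  rcases o with _ | ⟨q, y⟩
  · exact ⟨none, v, rfl⟩
  · exact ⟨some q, y ++ v, rfl⟩

theorem run_state_lt {Q Γ : Type} (δ : Q → Option α → Γ → Option (Q × List Γ)) (c L k : ℕ)
    (oq : Option Q) (x v : List Γ) (hx : x.length ≤ L) (w : List α) (hw : w.length < k) :
    ((runO (skδ δ c L k) L (some (mid L k oq x [] v)) w).map Prod.fst).map (fun s => s.2.2.1)
      = some w := by
  by_cases h : w = []
  · subst h
    simp [runO_nil, mid, trunc]
  · rw [run_partial δ c L k oq x v hx w h hw]
    simp [mid, trunc_val hw.le]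

theorem comp_inj (hk : 2 ≤ k)
    (hpre : ∀ oc u u', u.length = k → u'.length = k → ∀ r r',
      code oc u ++ r = code oc u' ++ r' → u = u')
    (hne : ∀ oc u, u.length = k → code oc u ≠ []) (n : ℕ) :
    ∀ (oq : Option G.Q) (x v : List G.Γ), x.length ≤ L → ∀ w w' : List α, w.length ≤ n →
      (comp G L k code).outFrom (some (mid L k oq x [] v)) w =
        (comp G L k code).outFrom (some (mid L k oq x [] v)) w' →
      (runO (skδ G.δ G.c L k) L (some (mid L k oq x [] v)) w).map Prod.fst =
        (runO (skδ G.δ G.c L k) L (some (mid L k oq x [] v)) w').map Prod.fst → w = w' := by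
  induction n using Nat.strong_induction_on with
  | _ n ih =>
  intro oq x v hx w w' hn ho hs
  have split : ∀ w : List α, k ≤ w.length → ∃ u r : List α, w = u ++ r ∧ u.length = k := by
    intro w hw
    exact ⟨w.take k, w.drop k, by simp, by simpa using hw⟩
  have long : ∀ u r : List α, u.length = k →
      (comp G L k code).outFrom (some (mid L k oq x [] v)) (u ++ r) =
      code (oapp oq ((x ++ v).take L)) u ++ (comp G L k code).outFrom
        (some (blockEnd L k ((x ++ v).drop L) (runO G.δ G.c (oapp oq ((x ++ v).take L)) u))) r := by
    intro u r hu
    rw [outFrom_append, comp_block G L k code hk oq x v hx u hu]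
    congr 2
    exact run_block G.δ G.c L k hk oq x v hx u hu
  rcases lt_or_ge w.length k with h | h <;> rcases lt_or_ge w'.length k with h' | h'
  · have e1 := run_state_lt G.δ G.c L k oq x v hx w h
    have e2 := run_state_lt G.δ G.c L k oq x v hx w' h'
    rw [hs, e2] at e1
    exact (Option.some.inj e1).symm
  · obtain ⟨u, r, rfl, hu⟩ := split w' h'
    rw [comp_partial G L k code oq x v hx w h, long u r hu] at ho
    exact absurd (List.append_eq_nil_iff.1 ho.symm).1 (hne _ _ hu)
  · obtain ⟨u, r, rfl, hu⟩ := split w h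
    rw [comp_partial G L k code oq x v hx w' h', long u r hu] at ho
    exact absurd (List.append_eq_nil_iff.1 ho).1 (hne _ _ hu)
  · obtain ⟨u, r, rfl, hu⟩ := split w h
    obtain ⟨u', r', rfl, hu'⟩ := split w' h'
    rw [long u r hu, long u' r' hu'] at ho
    have := hpre _ _ _ hu hu' _ _ ho
    subst this
    have ho' := List.append_cancel_left ho
    rw [runO_append, runO_append, run_block G.δ G.c L k hk oq x v hx u hu] at hs
    obtain ⟨oq1, v1, e⟩ := blockEnd_mid (α := α) L k ((x ++ v).drop L)
      (runO G.δ G.c (oapp oq ((x ++ v).take L)) u)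
    rw [e] at ho' hs
    simp only [List.length_append] at hn
    rw [ih (n - 1) (by omega) oq1 [] v1 (by simp) r r' (by omega) ho' hs]

theorem comp_IL (hL : 1 ≤ L) (hk : 2 ≤ k)
    (hpre : ∀ oc u u', u.length = k → u'.length = k → ∀ r r',
      code oc u ++ r = code oc u' ++ r' → u = u')
    (hne : ∀ oc u, u.length = k → code oc u ≠ []) : (comp G L k code).IL := by
  intro w w' h
  simp only [Prod.mk.injEq] at h
  exact comp_inj G L k code hk hpre hne w.length (some G.q0) [G.z0] [] (by simpa using hL) w w'
    le_rfl h.1 h.2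

theorem comp_main (hL1 : 1 ≤ L) (hL : (G.c + 1) * k ≤ L) (hk : 2 ≤ k) (h : ℕ)
    (hM : ∀ oc u, u.length = k → G.martFrom oc u * (Fintype.card α : ℝ) ^ (code oc u).length ≤
        (Fintype.card α : ℝ) ^ (k + 1 + h)) (j : ℕ) :
    ∀ w : List α, w.length = j * k →
      G.mart w * (Fintype.card α : ℝ) ^ ((comp G L k code).output w).length ≤
        (Fintype.card α : ℝ) ^ (j * (k + 1 + h)) ∧
      ∃ s, (comp G L k code).run w = some s ∧ Rel L k (G.run w) s := by
  induction j with
  | zero =>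
    intro w hw
    simp at hw
    subst hw
    constructor
    · simp [BPDG.mart, BPDC.output, BPDG.martFrom, BPDC.outFrom]
    · exact ⟨_, rfl, some G.q0, [G.z0], [], by simpa using hL1, rfl, rfl⟩
  | succ j ih =>
    intro w hw
    obtain ⟨w, u, rfl, hw1, hu⟩ : ∃ w' u : List α, w = w' ++ u ∧ w'.length = j * k ∧ u.length = k :=
      ⟨w.take (j * k), w.drop (j * k), by simp, by simp [hw, Nat.add_mul],
        by simp [hw, Nat.add_mul]⟩
    obtain ⟨h1, s, h2, oq, x, v, hx, rfl, h3⟩ := ih w hw1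
    have r1 : G.run (w ++ u) = runO G.δ G.c (oapp oq (x ++ v)) u := by
      rw [← h3]; exact runO_append G.δ G.c _ w u
    have r2 : (comp G L k code).run (w ++ u) =
        runO (skδ G.δ G.c L k) L (some (mid L k oq x [] v)) u := by
      refine (runO_append (skδ G.δ G.c L k) L _ w u).trans ?_
      exact congrArg (fun o => runO (skδ G.δ G.c L k) L o u) h2
    have m1 : G.mart (w ++ u) = G.mart w * G.martFrom (oapp oq (x ++ v)) u := by
      rw [← h3]; exact martFrom_append G w u _
    have m2 : (comp G L k code).output (w ++ u) = (comp G L k code).output w ++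
        code (oapp oq ((x ++ v).take L)) u := by
      rw [← comp_block G L k code hk oq x v hx u hu, ← h2]; exact outFrom_append _ w u _
    constructor
    · rw [m1, m2, List.length_append, pow_add, martFrom_take G L oq _ u (by rw [hu]; exact hL),
        mul_mul_mul_comm, Nat.add_mul, Nat.one_mul, pow_add]
      have := martFrom_nonneg G u (oapp oq ((x ++ v).take L))
      exact mul_le_mul h1 (hM _ u hu) (by positivity) (by positivity)
    · refine ⟨_, r2.trans (run_block G.δ G.c L k hk oq x v hx u hu), ?_⟩
      rw [r1]
      exact rel_block G.δ G.c L k hL oq (x ++ v) u hu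

theorem comp_main' [Nonempty α] (hL1 : 1 ≤ L) (hL : (G.c + 1) * k ≤ L) (hk : 2 ≤ k) (h : ℕ)
    (hM : ∀ oc u, u.length = k → G.martFrom oc u * (Fintype.card α : ℝ) ^ (code oc u).length ≤
        (Fintype.card α : ℝ) ^ (k + 1 + h)) (w : List α) :
      G.mart w * (Fintype.card α : ℝ) ^ ((comp G L k code).output w).length ≤
        (Fintype.card α : ℝ) ^ (w.length + (w.length / k) * (1 + h)) := by
  obtain ⟨w, u, rfl, hw1, hu⟩ : ∃ w' u : List α, w = w' ++ u ∧ w'.length = (w.length / k) * k ∧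
      u.length = w.length % k := by
    have := Nat.div_add_mod w.length k
    rw [mul_comm] at this
    exact ⟨w.take (w.length / k * k), w.drop (w.length / k * k), by simp, by simp; omega,
        by simp; omega⟩
  set j := (w ++ u).length / k with hj
  obtain ⟨h1, s, h2, oq, x, v, hx, rfl, h3⟩ := comp_main G L k code hL1 hL hk h hM j w hw1
  have hu' : u.length < k := by rw [hu]; exact Nat.mod_lt _ (by omega)
  have m1 : G.mart (w ++ u) = G.mart w * G.martFrom (oapp oq (x ++ v)) u := by
    rw [← h3]; exact martFrom_append G w u _
  have m2 : (comp G L k code).output (w ++ u) = (comp G L k code).output w := by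
    have := comp_partial G L k code oq x v hx u hu'
    rw [← h2] at this
    conv_rhs => rw [← List.append_nil ((comp G L k code).output w), ← this]
    exact outFrom_append _ w u _
  rw [m1, m2, mul_right_comm]
  have e : (w ++ u).length + j * (1 + h) = j * (k + 1 + h) + u.length := by
    rw [List.length_append, hw1]; ring
  rw [e, pow_add]
  exact mul_le_mul h1 (martFrom_le G u _) (martFrom_nonneg _ _ _) (by positivity)

theorem length_strPrefix (S : ℕ → α) (n : ℕ) : (strPrefix S n).length = n := by
  simp [strPrefix]

theorem succeeds_frequently (d : List α → ℝ) (S : ℕ → α) (h : succeedsOn d S) :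
    ∃ᶠ n in Filter.atTop, 1 < d (strPrefix S n) := by
  rw [Filter.frequently_atTop]
  intro N
  obtain ⟨n, hn⟩ := h (1 + ∑ i ∈ Finset.range N, |d (strPrefix S i)|)
  have h0 : 0 ≤ ∑ i ∈ Finset.range N, |d (strPrefix S i)| :=
    Finset.sum_nonneg (fun i _ => abs_nonneg _)
  refine ⟨n, ?_, by linarith⟩
  by_contra hlt
  have h1 := Finset.single_le_sum (f := fun i => |d (strPrefix S i)|)
    (fun i _ => abs_nonneg _) (Finset.mem_range.2 (not_le.1 hlt))
  have h2 := le_abs_self (d (strPrefix S n))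
  linarith

theorem exists_h (ε : ℝ) (hε : 0 < ε) : ∃ h : ℕ, 2 ≤ h ∧ ((1 : ℝ) + h) ≤ ε * (2 ^ h - 1 : ℝ) := by
  have h1 : Filter.Tendsto (fun n : ℕ => ((n : ℝ) ^ 1) / (2 : ℝ) ^ n) Filter.atTop (nhds 0) :=
    tendsto_pow_const_div_const_pow_of_one_lt 1 (by norm_num)
  have h2 := (h1.eventually (gt_mem_nhds (show (0 : ℝ) < ε / 4 by positivity))).and
    (Filter.eventually_ge_atTop 2)
  obtain ⟨h, h3, h4⟩ := h2.exists
  refine ⟨h, h4, ?_⟩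
  rw [pow_one, div_lt_iff₀ (by positivity)] at h3
  have h5 : (2 : ℝ) ≤ h := by exact_mod_cast h4
  have h6 : (2 : ℝ) ≤ 2 ^ h := by
    calc (2 : ℝ) = 2 ^ 1 := by norm_num
      _ ≤ 2 ^ h := pow_le_pow_right₀ (by norm_num) (by omega)
  nlinarith

/-- From a gambler to a compressor. -/
theorem dir2 (hα : 2 ≤ Fintype.card α) (S : ℕ → α) (s : ℝ) (hs : succeedsOn (G.sgale s) S)
    (ε : ℝ) (hε : 0 < ε) : ∃ C : BPDC α, C.IL ∧ C.compRatio S ≤ s + ε := by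
  haveI : Nonempty α := Fintype.card_pos_iff.1 (by omega)
  obtain ⟨h, h2, hh⟩ := exists_h ε hε
  have h22 : 2 ^ 2 ≤ 2 ^ h := Nat.pow_le_pow_right (by norm_num) h2
  obtain ⟨k, hk⟩ : ∃ k, k + 1 = 2 ^ h := ⟨2 ^ h - 1, by omega⟩
  have hkA : k + 1 ≤ Fintype.card α ^ h := by rw [hk]; exact Nat.pow_le_pow_left hα h
  have hkr : (k : ℝ) = 2 ^ h - 1 := by
    have : ((k + 1 : ℕ) : ℝ) = ((2 ^ h : ℕ) : ℝ) := by rw [hk]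
    push_cast at this
    linarith
  have hk2 : 2 ≤ k := by omega
  have hcode := fun oc => exists_code k h hkA (by omega) (G.martFrom oc)
    (fun u => martFrom_nonneg G u oc) (martFrom_sum G k oc)
  choose code hpre hne hM using hcode
  let L := (G.c + 1) * k
  have hL1 : 1 ≤ L := Nat.mul_pos (by omega) (by omega)
  refine ⟨comp G L k code, comp_IL G L k code hL1 hk2 hpre hne, ?_⟩
  have hA1 : (1 : ℝ) < Fintype.card α := by exact_mod_cast (by omega : 1 < Fintype.card α)
  have hA0 : (0 : ℝ) < Fintype.card α := by linarith
  unfold BPDC.compRatio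
  refine Filter.liminf_le_of_frequently_le ?_ ⟨0, by
    simp only [Filter.eventually_map]
    exact Filter.Eventually.of_forall (fun n => by positivity)⟩
  refine ((succeeds_frequently _ S hs).and_eventually (Filter.eventually_ge_atTop 1)).mono ?_
  rintro n ⟨hn, hn1⟩
  have hn0 : (0 : ℝ) < n := by exact_mod_cast hn1
  rw [div_le_iff₀ hn0]
  have key := comp_main' G L k code hL1 le_rfl hk2 h hM (strPrefix S n)
  set ℓ := ((comp G L k code).output (strPrefix S n)).length
  simp only [BPDG.sgale, length_strPrefix] at hn key
  set A : ℝ := (Fintype.card α : ℝ)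
  have e1 : A ^ ((s - 1) * (n : ℝ)) * A ^ (n + n / k * (1 + h)) =
      A ^ (s * n + ((n / k : ℕ) : ℝ) * (1 + h)) := by
    rw [← Real.rpow_natCast A (n + n / k * (1 + h)), ← Real.rpow_add hA0]
    congr 1
    push_cast
    ring
  have e2 : A ^ (ℓ : ℝ) ≤ A ^ (s * n + ((n / k : ℕ) : ℝ) * (1 + h)) := by
    rw [← e1, Real.rpow_natCast]
    have p1 : 0 < A ^ ((s - 1) * (n : ℝ)) := Real.rpow_pos_of_pos hA0 _
    have p2 : 0 < A ^ ℓ := by positivity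
    calc A ^ ℓ ≤ (A ^ ((s - 1) * (n : ℝ)) * G.mart (strPrefix S n)) * A ^ ℓ :=
          le_mul_of_one_le_left p2.le hn.le
      _ = A ^ ((s - 1) * (n : ℝ)) * (G.mart (strPrefix S n) * A ^ ℓ) := by ring
      _ ≤ _ := mul_le_mul_of_nonneg_left key p1.le
  have e3 := (Real.rpow_le_rpow_left_iff hA1).1 e2
  have e4 : ((n / k : ℕ) : ℝ) * k ≤ n := by exact_mod_cast Nat.div_mul_le_self n k
  have e5 : (0 : ℝ) ≤ ((n / k : ℕ) : ℝ) := by positivity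
  rw [← hkr] at hh
  nlinarith [mul_le_mul_of_nonneg_left hh e5, mul_le_mul_of_nonneg_left e4 hε.le]

end Compress

section Gamble

variable {α : Type} [Fintype α]

/-- Weight of a string according to the length of the output. -/
def wt (C : BPDC α) (oc : Option (C.Q × List C.Γ)) (u : List α) : ℚ :=
  ((Fintype.card α : ℚ) ^ (C.outFrom oc u).length)⁻¹

theorem wt_pos [Nonempty α] (C : BPDC α) (oc : Option (C.Q × List C.Γ)) (u : List α) :
    0 < wt C oc u := by
  unfold wt
  have : (0 : ℚ) < Fintype.card α := by exact_mod_cast Fintype.card_pos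
  positivity

/-- The block gambler built from a compressor. -/
noncomputable def gam [Nonempty α] (C : BPDC α) (L k : ℕ) : BPDG α where
  Q := SkQ α C.Q C.Γ L k
  Γ := Option C.Γ
  fintypeQ := by
    haveI := C.fintypeQ
    haveI := C.fintypeΓ
    exact Fintype.ofFinite _
  fintypeΓ := by
    haveI := C.fintypeΓ
    exact inferInstance
  δ := skδ C.δ C.c L k
  β := fun s _ b => if s.2.2.1.length = 0 then 1 / (Fintype.card α : ℚ) else
    W (wt C (oapp s.1 s.2.1.1)) (k - 1 - s.2.2.1.length) (s.2.2.1 ++ [b]) /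
    ∑ b', W (wt C (oapp s.1 s.2.1.1)) (k - 1 - s.2.2.1.length) (s.2.2.1 ++ [b'])
  q0 := (some C.q0, trunc L [C.z0], trunc k [])
  z0 := none
  c := L
  β_nonneg := by
    intro s a b
    split_ifs
    · positivity
    · exact div_nonneg (W_pos _ (wt_pos C _) _ _).le
        (Finset.sum_nonneg fun b' _ => (W_pos _ (wt_pos C _) _ _).le)
  β_sum := by
    intro s a
    split_ifs
    · simp
    · rw [← Finset.sum_div, div_self]
      exact (Finset.sum_pos (fun b' _ => W_pos _ (wt_pos C _) _ _) Finset.univ_nonempty).ne'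
  det := skδ_det C.δ C.c L k
  bottom := skδ_bottom C.δ C.c L k
  lamBound := skδ_lamBound C.δ C.c L k

variable [Nonempty α] (C : BPDC α) (L k : ℕ)

theorem gam_betAt_nil (oq : Option C.Q) (x : List C.Γ) (v : List C.Γ) (b : α) :
    (gam C L k).betAt (some (mid L k oq x [] v)) b = 1 / (Fintype.card α : ℝ) := by
  have h2 : (trunc k ([] : List α)).1 = [] := trunc_val (by simp)
  cases v <;> simp [BPDG.betAt, mid, gam, h2]

theorem gam_betAt (oq : Option C.Q) (x : List C.Γ) (u : List α) (v : List C.Γ) (b : α)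
    (hx : x.length ≤ L) (hu : u.length < k) (hu0 : u ≠ []) :
    (gam C L k).betAt (some (mid L k oq x u v)) b =
      ((W (wt C (oapp oq x)) (k - 1 - u.length) (u ++ [b]) : ℚ) : ℝ) /
      ((W (wt C (oapp oq x)) (k - u.length) u : ℚ) : ℝ) := by
  have h1 := trunc_val hx
  have h2 := trunc_val hu.le
  have e : k - u.length = (k - 1 - u.length) + 1 := by omega
  rw [e]
  cases v <;> simp [BPDG.betAt, mid, gam, h1, h2, hu0, W]

theorem gam_partial (oq : Option C.Q) (x v : List C.Γ) (hx : x.length ≤ L) (b0 : α) (t : List α)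
    (ht : t.length + 1 ≤ k) :
    (gam C L k).martFrom (some (mid L k oq x [] v)) (b0 :: t) =
      (Fintype.card α : ℝ) ^ t.length *
        ((W (wt C (oapp oq ((x ++ v).take L))) (k - 1 - t.length) (b0 :: t) : ℚ) : ℝ) /
        ((W (wt C (oapp oq ((x ++ v).take L))) (k - 1) [b0] : ℚ) : ℝ) := by
  have hA : (Fintype.card α : ℝ) ≠ 0 := by exact_mod_cast (Fintype.card_pos (α := α)).ne'
  have hW : ∀ j u, ((W (wt C (oapp oq ((x ++ v).take L))) j u : ℚ) : ℝ) ≠ 0 := by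
    intro j u
    exact_mod_cast (W_pos _ (wt_pos C _) j u).ne'
  induction t using List.reverseRecOn with
  | nil =>
    simp only [BPDG.martFrom]
    rw [gam_betAt_nil]
    have := hW (k - 1) [b0]
    simp
    field_simp
  | append_singleton t b ih =>
    simp only [List.length_append, List.length_singleton] at ht ⊢
    rw [← List.cons_append, martFrom_append, ih (by omega)]
    have hr := run_partial C.δ C.c L k oq x v hx (b0 :: t) (by simp) (by simp; omega)
    have hb : (gam C L k).betAt (runO (gam C L k).δ (gam C L k).c
        (some (mid L k oq x [] v)) (b0 :: t)) b = _ :=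
      (congrArg (fun o => (gam C L k).betAt o b) hr).trans
        (gam_betAt C L k oq _ (b0 :: t) _ b (by simp) (by simp; omega) (by simp))
    simp only [BPDG.martFrom]
    rw [hb]
    have e1 : k - (b0 :: t).length = k - 1 - t.length := by simp; omega
    have e2 : k - 1 - (b0 :: t).length = k - 1 - (t.length + 1) := by simp
    rw [e1, e2]
    have := hW (k - 1) [b0]
    have := hW (k - 1 - t.length) (b0 :: t)
    field_simp
    rw [pow_succ, mul_comm]

theorem W_congr (f g : List α → ℚ) (j : ℕ) (u : List α)
    (h : ∀ w, w.length = u.length + j → f w = g w) : W f j u = W g j u := by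
  rw [W_eq_sum, W_eq_sum]
  exact Finset.sum_congr rfl fun v _ => h _ (by simp)

/-- The loss per block. -/
noncomputable def loss (C : BPDC α) (k : ℕ) : ℕ :=
  (@Fintype.card C.Q C.fintypeQ + 1) * (k * C.maxOut + 1)

theorem gam_main (hIL : C.IL) (hL1 : 1 ≤ L) (hL : (C.c + 1) * k ≤ L) (hk : 2 ≤ k) (j : ℕ) :
    ∀ w : List α, w.length = j * k →
      (Fintype.card α : ℝ) ^ (j * k) ≤
      (gam C L k).mart w * (Fintype.card α : ℝ) ^ (C.output w).length *
        ((Fintype.card α : ℝ) * loss C k) ^ j ∧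
      ∃ s, (gam C L k).run w = some s ∧ Rel L k (C.run w) s := by
  classical
  induction j with
  | zero =>
    intro w hw
    simp at hw
    subst hw
    constructor
    · simp [BPDG.mart, BPDC.output, BPDG.martFrom, BPDC.outFrom]
    · exact ⟨_, rfl, some C.q0, [C.z0], [], by simpa using hL1, rfl, rfl⟩
  | succ j ih =>
    intro w hw
    obtain ⟨w, u, rfl, hw1, hu⟩ : ∃ w' u : List α, w = w' ++ u ∧ w'.length = j * k ∧ u.length = k :=
      ⟨w.take (j * k), w.drop (j * k), by simp, by simp [hw, Nat.add_mul],
        by simp [hw, Nat.add_mul]⟩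
    obtain ⟨h1, s, h2, oq, x, v, hx, rfl, h3⟩ := ih w hw1
    have r1 : C.run (w ++ u) = runO C.δ C.c (oapp oq (x ++ v)) u := by
      rw [← h3]; exact runO_append C.δ C.c _ w u
    have r2 : (gam C L k).run (w ++ u) =
        runO (skδ C.δ C.c L k) L (some (mid L k oq x [] v)) u := by
      refine (runO_append (skδ C.δ C.c L k) L _ w u).trans ?_
      exact congrArg (fun o => runO (skδ C.δ C.c L k) L o u) h2
    have m1 : ∀ u, C.output (w ++ u) = C.output w ++ C.outFrom (oapp oq (x ++ v)) u := by
      intro u; rw [← h3]; exact outFrom_append C w u _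
    have r1' : ∀ u, C.run (w ++ u) = runO C.δ C.c (oapp oq (x ++ v)) u := by
      intro u; rw [← h3]; exact runO_append C.δ C.c _ w u
    have m2 : (gam C L k).mart (w ++ u) = (gam C L k).mart w *
        (gam C L k).martFrom (some (mid L k oq x [] v)) u := by
      refine (martFrom_append (gam C L k) w u _).trans ?_
      exact congrArg (fun o => (gam C L k).mart w * (gam C L k).martFrom o u) h2
    constructor
    · cases u with
      | nil => simp at hu; omega
      | cons b0 t =>
        simp only [List.length_cons] at hu
        have hkey := gam_partial C L k oq x v hx b0 t (by omega)
        have hWeq : W (wt C (oapp oq ((x ++ v).take L))) (k - 1) [b0] =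
            W (wt C (oapp oq (x ++ v))) (k - 1) [b0] := by
          apply W_congr
          intro w hw
          unfold wt
          rw [outFrom_take C L oq (x ++ v) w]
          have : w.length = k := by rw [hw]; simp; omega
          rw [this]
          exact hL
        have hK : W (wt C (oapp oq (x ++ v))) (k - 1) [b0] ≤ (loss C k : ℕ) := by
          letI := C.fintypeQ
          have := kraft (T := Option C.Q) (k - 1) (k * C.maxOut) [b0]
            (C.outFrom (oapp oq (x ++ v)))
            (fun u => (runO C.δ C.c (oapp oq (x ++ v)) u).map Prod.fst)
            (by
              intro a a' e1 e2
              have := @hIL (w ++ a) (w ++ a') (by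
                simp only [Prod.mk.injEq]
                rw [m1, m1, r1', r1', e1]
                exact ⟨rfl, e2⟩)
              exact List.append_cancel_left this)
            (by
              intro a ha
              have h1 := outFrom_le C a (oapp oq (x ++ v))
              have : a.length = k := by rw [ha]; simp; omega
              rwa [this] at h1)
          refine this.trans (le_of_eq ?_)
          simp [loss]
        rw [← hWeq] at hK
        have h0 : k - 1 - t.length = 0 := by omega
        have ht : t.length = k - 1 := by omega
        rw [h0] at hkey
        simp only [W] at hkey
        rw [m1, m2, hkey, List.length_append, ht]
        rw [outFrom_take C L oq (x ++ v) (b0 :: t) (by simp only [List.length_cons, hu]; exact hL)]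
        simp only [wt]
        push_cast
        set A : ℝ := (Fintype.card α : ℝ) with hA
        have hA0 : 0 < A := by rw [hA]; exact_mod_cast Fintype.card_pos
        have hWp : (0 : ℝ) < ((W (wt C (oapp oq ((x ++ v).take L))) (k - 1) [b0] : ℚ) : ℝ) := by
          exact_mod_cast W_pos _ (wt_pos C _) _ _
        have hKr : ((W (wt C (oapp oq ((x ++ v).take L))) (k - 1) [b0] : ℚ) : ℝ) ≤ (loss C k : ℝ) := by
          exact_mod_cast hK
        set Wv : ℝ := ((W (wt C (oapp oq ((x ++ v).take L))) (k - 1) [b0] : ℚ) : ℝ)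
        have hWv : ((W (fun u => (((Fintype.card α : ℚ) ^
            (C.outFrom (oapp oq ((x ++ v).take L)) u).length)⁻¹)) (k - 1) [b0] : ℚ) : ℝ) = Wv := rfl
        try rw [hWv]
        set o := (C.outFrom (oapp oq ((x ++ v).take L)) (b0 :: t)).length
        set D : ℝ := (loss C k : ℝ)
        have hk' : A ^ k = A ^ (k - 1) * A := by
          rw [← pow_succ]; congr 1; omega
        have hpo : 0 < A ^ o := by positivity
        have e1 : (gam C L k).mart w * (A ^ (k - 1) * (A ^ o)⁻¹ / Wv) *
            A ^ ((C.output w).length + o) * (A * D) ^ (j + 1) =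
            ((gam C L k).mart w * A ^ (C.output w).length * (A * D) ^ j) *
              (A ^ k * (D / Wv)) := by
          rw [hk', pow_add, pow_succ]
          field_simp
        rw [e1, Nat.add_mul, Nat.one_mul, pow_add]
        have hDW : 1 ≤ D / Wv := by rw [le_div_iff₀ hWp]; simpa using hKr
        refine mul_le_mul h1 ?_ (by positivity) (le_trans (by positivity) h1)
        exact le_mul_of_one_le_right (by positivity) hDW
    · refine ⟨_, r2.trans (run_block C.δ C.c L k hk oq x v hx u hu), ?_⟩
      rw [r1]
      exact rel_block C.δ C.c L k hL oq (x ++ v) u hu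

theorem ratio_le (S : ℕ → α) (n : ℕ) :
    ((C.output (strPrefix S n)).length : ℝ) / n ≤ C.maxOut := by
  rcases Nat.eq_zero_or_pos n with rfl | hn
  · simp
  · have hn' : (0 : ℝ) < n := by exact_mod_cast hn
    rw [div_le_iff₀ hn']
    have := outFrom_le C (strPrefix S n) (some (C.q0, [C.z0]))
    rw [length_strPrefix, mul_comm] at this
    exact_mod_cast this

theorem ratio_cobdd (S : ℕ → α) : Filter.IsCoboundedUnder (· ≥ ·) Filter.atTop
    (fun n : ℕ => ((C.output (strPrefix S n)).length : ℝ) / n) := by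
  apply Filter.IsBoundedUnder.isCoboundedUnder_ge
  refine ⟨C.maxOut, ?_⟩
  simp only [Filter.eventually_map]
  exact Filter.Eventually.of_forall (fun n => ratio_le C S n)

theorem compRatio_nonneg (S : ℕ → α) : 0 ≤ C.compRatio S := by
  apply Filter.le_liminf_of_le (ratio_cobdd C S)
  exact Filter.Eventually.of_forall (fun n => by positivity)

theorem exists_k (A ε : ℝ) (hA : 1 < A) (hε : 0 < ε) :
    ∃ k : ℕ, 2 ≤ k ∧ A * loss C k ≤ A ^ (ε * k) := by
  set B := A ^ ε with hB
  have hB1 : 1 < B := Real.one_lt_rpow hA hε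
  set q : ℝ := (@Fintype.card C.Q C.fintypeQ : ℝ)
  set K : ℝ := A * (q + 1) * (C.maxOut + 1) with hK
  have hK0 : 0 < K := by positivity
  have h1 : Filter.Tendsto (fun n : ℕ => ((n : ℝ) ^ 1) / B ^ n) Filter.atTop (nhds 0) :=
    tendsto_pow_const_div_const_pow_of_one_lt 1 hB1
  have h2 := (h1.eventually (gt_mem_nhds (show (0 : ℝ) < 1 / K by positivity))).and
    (Filter.eventually_ge_atTop 2)
  obtain ⟨k, h3, h4⟩ := h2.exists
  refine ⟨k, h4, ?_⟩
  have hBk : 0 < B ^ k := by positivity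
  rw [pow_one, div_lt_div_iff₀ hBk hK0] at h3
  rw [Real.rpow_mul (by linarith), Real.rpow_natCast, ← hB]
  have hk1 : (1 : ℝ) ≤ k := by exact_mod_cast (by omega : 1 ≤ k)
  have : A * (loss C k : ℝ) ≤ k * K := by
    simp only [loss, hK]
    push_cast
    have : (k : ℝ) * C.maxOut + 1 ≤ k * (C.maxOut + 1) := by linarith
    calc A * ((q + 1) * ((k : ℝ) * C.maxOut + 1))
        ≤ A * ((q + 1) * (k * (C.maxOut + 1))) := by gcongr
      _ = _ := by ring
  linarith

theorem output_mono (S : ℕ → α) (m n : ℕ) (h : m ≤ n) :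
    (C.output (strPrefix S m)).length ≤ (C.output (strPrefix S n)).length := by
  obtain ⟨d, rfl⟩ := Nat.exists_eq_add_of_le h
  have : strPrefix S (m + d) = strPrefix S m ++ (List.range d).map (fun i => S (m + i)) := by
    simp [strPrefix, List.range_add, Function.comp_def]
  rw [this, BPDC.output, BPDC.output, outFrom_append]
  simp

/-- From a compressor to a gambler. -/
theorem dir1 (hα : 2 ≤ Fintype.card α) (S : ℕ → α) (hIL : C.IL) (s : ℝ)
    (hs : C.compRatio S < s) : ∃ G : BPDG α, succeedsOn (G.sgale s) S := by
  set r := C.compRatio S with hr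
  have hr0 : 0 ≤ r := compRatio_nonneg C S
  set ε := (s - r) / 4 with hε
  have hε0 : 0 < ε := by rw [hε]; linarith
  set A : ℝ := (Fintype.card α : ℝ) with hA
  have hA1 : 1 < A := by rw [hA]; exact_mod_cast (by omega : 1 < Fintype.card α)
  have hA0 : 0 < A := by linarith
  obtain ⟨k, hk2, hk⟩ := exists_k C A ε hA1 hε0
  let L := (C.c + 1) * k
  have hL1 : 1 ≤ L := Nat.mul_pos (by omega) (by omega)
  refine ⟨gam C L k, ?_⟩
  intro Cst
  have hfreq : ∃ᶠ n in Filter.atTop, ((C.output (strPrefix S n)).length : ℝ) / n < r + ε :=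
    Filter.frequently_lt_of_liminf_lt (ratio_cobdd C S) (by
      change C.compRatio S < r + ε
      linarith)
  obtain ⟨E, hE⟩ : ∃ E : ℝ, Cst < A ^ E := by
    obtain ⟨n, hn⟩ := pow_unbounded_of_one_lt Cst hA1
    exact ⟨n, by rwa [Real.rpow_natCast]⟩
  obtain ⟨N0, hN0⟩ := exists_nat_ge (((r + ε) * k + E) / (2 * ε) + k)
  obtain ⟨n, hn, hn2⟩ := (hfreq.and_eventually (Filter.eventually_ge_atTop (max N0 1))).exists
  have hn1 : 1 ≤ n := (le_max_right _ _).trans hn2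
  have hnN : (N0 : ℝ) ≤ n := by exact_mod_cast (le_max_left _ _).trans hn2
  have hn0 : (0 : ℝ) < n := by exact_mod_cast hn1
  rw [div_lt_iff₀ hn0] at hn
  set j := n / k with hj
  refine ⟨j * k, ?_⟩
  have hjn : j * k ≤ n := Nat.div_mul_le_self n k
  have hjk : n ≤ j * k + k := by
    have h1 := Nat.div_add_mod n k
    have h2 := Nat.mod_lt n (show 0 < k by omega)
    rw [← hj, mul_comm] at h1
    omega
  have hjk' : (n : ℝ) ≤ (j * k : ℕ) + k := by exact_mod_cast hjk
  obtain ⟨h1, -⟩ := gam_main C L k hIL hL1 le_rfl hk2 j (strPrefix S (j * k)) (length_strPrefix S _)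
  have hmono : ((C.output (strPrefix S (j * k))).length : ℝ) ≤
      (C.output (strPrefix S n)).length := by
    exact_mod_cast output_mono C S (j * k) n hjn
  set o := (C.output (strPrefix S (j * k))).length
  set d := (gam C L k).mart (strPrefix S (j * k))
  have hd : 0 ≤ d := martFrom_nonneg _ _ _
  rw [← hA] at h1
  simp only [BPDG.sgale, length_strPrefix]
  set N : ℕ := j * k with hN
  have h2 : A ^ (N : ℝ) ≤ d * A ^ ((o : ℝ) + ε * N) := by
    rw [Real.rpow_natCast]
    refine h1.trans ?_
    rw [Real.rpow_add hA0, Real.rpow_natCast, mul_assoc]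
    have : (A * (loss C k : ℝ)) ^ j ≤ A ^ (ε * (N : ℝ)) := by
      calc (A * (loss C k : ℝ)) ^ j ≤ (A ^ (ε * k)) ^ j := by gcongr
        _ = _ := by
          rw [← Real.rpow_natCast, ← Real.rpow_mul hA0.le]
          congr 1
          rw [hN]; push_cast; ring
    gcongr
  have h3 : A ^ ((s - ε) * N - o) ≤ A ^ ((s - 1) * (N : ℝ)) * d := by
    have e : A ^ ((s - ε) * N - o) = A ^ ((s - 1) * (N : ℝ)) * A ^ (N : ℝ) *
        A ^ (-((o : ℝ) + ε * N)) := by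
      rw [← Real.rpow_add hA0, ← Real.rpow_add hA0]
      congr 1; ring
    rw [e, mul_assoc, Real.rpow_neg hA0.le]
    have p : 0 < A ^ ((o : ℝ) + ε * N) := Real.rpow_pos_of_pos hA0 _
    apply mul_le_mul_of_nonneg_left _ (Real.rpow_pos_of_pos hA0 _).le
    rwa [← div_eq_mul_inv, div_le_iff₀ p]
  refine lt_of_lt_of_le (lt_of_lt_of_le hE ?_) h3
  apply Real.rpow_le_rpow_of_exponent_le hA1.le
  have h4 : ((r + ε) * k + E) / (2 * ε) ≤ N := by linarith
  rw [div_le_iff₀ (by positivity)] at h4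
  have h5 : (r + ε) * n ≤ (r + ε) * (N + k) := by gcongr
  have h6 : s = r + 4 * ε := by rw [hε]; ring
  rw [h6]
  nlinarith

end Gamble

section Final

variable {α : Type} [Fintype α]

/-- The trivial gambler. -/
def triv [Nonempty α] : BPDG α where
  Q := Unit
  Γ := Unit
  fintypeQ := inferInstance
  fintypeΓ := inferInstance
  δ := fun _ _ _ => none
  β := fun _ _ _ => 1 / (Fintype.card α : ℚ)
  q0 := ()
  z0 := ()
  c := 0
  β_nonneg := by intros; positivity
  β_sum := by intros; simp
  det := by intros; left; rfl
  bottom := by intros; left; rfl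
  lamBound := by
    rintro ⟨q, _ | ⟨a, v⟩⟩ <;> rfl

theorem triv_mart [Nonempty α] (w : List α) : ∀ oc, (triv (α := α)).martFrom oc w = 1 := by
  induction w with
  | nil => intro oc; rfl
  | cons b w ih =>
    intro oc
    simp only [BPDG.martFrom, ih]
    rcases oc with _ | ⟨q, _ | ⟨a, v⟩⟩ <;> simp [BPDG.betAt, triv]

theorem triv_succ [Nonempty α] (hα : 2 ≤ Fintype.card α) (S : ℕ → α) :
    succeedsOn ((triv (α := α)).sgale 2) S := by
  intro Cst
  have hA1 : (1 : ℝ) < Fintype.card α := by exact_mod_cast (by omega : 1 < Fintype.card α)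
  obtain ⟨n, hn⟩ := pow_unbounded_of_one_lt Cst hA1
  refine ⟨n, ?_⟩
  simp only [BPDG.sgale, BPDG.mart, triv_mart, length_strPrefix]
  norm_num
  exact hn

end Final

end BPDProof

/-- For every sequence `S ∈ Σ^∞`, the bounded pushdown
dimension of `S` equals its bounded pushdown compression ratio:
`dim_BPD(S) = ρ_BPD(S)`. -/
theorem dimBPD_eq_rhoBPD {α : Type} [Fintype α] (hα : 2 ≤ Fintype.card α)
    (S : ℕ → α) :
    dimBPD S = rhoBPD S := by
  haveI : Nonempty α := Fintype.card_pos_iff.1 (by omega)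
  have b1 : BddBelow {s : ℝ | 0 ≤ s ∧ ∃ G : BPDG α, succeedsOn (G.sgale s) S} :=
    ⟨0, fun s hs => hs.1⟩
  have b2 : BddBelow {r : ℝ | ∃ C : BPDC α, C.IL ∧ C.compRatio S = r} := by
    refine ⟨0, ?_⟩
    rintro r ⟨C, -, rfl⟩
    exact BPDProof.compRatio_nonneg C S
  have n1 : {s : ℝ | 0 ≤ s ∧ ∃ G : BPDG α, succeedsOn (G.sgale s) S}.Nonempty :=
    ⟨2, by norm_num, BPDProof.triv, BPDProof.triv_succ hα S⟩
  have n2 : {r : ℝ | ∃ C : BPDC α, C.IL ∧ C.compRatio S = r}.Nonempty := by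
    obtain ⟨s, -, G, hG⟩ := n1
    obtain ⟨C, hC, -⟩ := BPDProof.dir2 G hα S s hG 1 one_pos
    exact ⟨_, C, hC, rfl⟩
  apply le_antisymm
  · refine le_csInf n2 ?_
    rintro r ⟨C, hC, rfl⟩
    refine le_of_forall_gt_imp_ge_of_dense fun s hs => ?_
    exact csInf_le b1 ⟨(BPDProof.compRatio_nonneg C S).trans hs.le,
      BPDProof.dir1 C hα S hC s hs⟩
  · refine le_csInf n1 ?_
    rintro s ⟨-, G, hG⟩
    refine le_of_forall_pos_le_add fun ε hε => ?_
    obtain ⟨C, hC, hCs⟩ := BPDProof.dir2 G hα S s hG ε hε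
    exact (csInf_le b2 ⟨C, hC, rfl⟩).trans hCs
end

section
/- For every bounded pushdown gambler G and every ε > 0, there exists a nonvanishing bounded pushdown gambler G′ (i.e., one with 0 < β′(q,z)(b) < 1 for all states q, stack symbols z and input symbols b) such that for all w ∈ Σ*, d_{G′}(w) ≥ |Σ|^{−ε|w|} d_G(w). -/
/-- The gambler `G` with its bets mixed with the uniform bet, with weight `t`. -/
def BPDG.mix {α : Type} [Fintype α] (hα : 2 ≤ Fintype.card α) (G : BPDG α) (t : ℚ)
    (h0 : 0 < t) (h1 : t < 1) : BPDG α where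
  Q := G.Q
  Γ := G.Γ
  fintypeQ := G.fintypeQ
  fintypeΓ := G.fintypeΓ
  δ := G.δ
  β := fun q a b => (1 - t) * G.β q a b + t / (Fintype.card α : ℚ)
  q0 := G.q0
  z0 := G.z0
  c := G.c
  β_nonneg := fun q a b => by
    have := G.β_nonneg q a b
    have h2 : 0 ≤ 1 - t := by linarith
    positivity
  β_sum := fun q a => by
    have hk : (Fintype.card α : ℚ) ≠ 0 := by
      have : Fintype.card α ≠ 0 := by omega
      exact_mod_cast this
    rw [Finset.sum_add_distrib, ← Finset.mul_sum, G.β_sum]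
    simp only [Finset.sum_const, Finset.card_univ, nsmul_eq_mul]
    field_simp
    ring
  det := G.det
  bottom := G.bottom
  lamBound := G.lamBound

theorem BPDG.mix_betAt {α : Type} [Fintype α] (hα : 2 ≤ Fintype.card α) (G : BPDG α)
    (t : ℚ) (h0 : 0 < t) (h1 : t < 1) (r : ℝ) (hr : r ≤ 1 - (t : ℝ))
    (b : α) (o : Option (G.Q × List G.Γ)) :
    0 ≤ G.betAt o b ∧ r * G.betAt o b ≤ (G.mix hα t h0 h1).betAt o b := by
  have ht : (0 : ℝ) < t := by exact_mod_cast h0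
  have hd1 : (0 : ℝ) ≤ 1 / (Fintype.card α : ℝ) := by positivity
  have hd2 : r * (1 / (Fintype.card α : ℝ)) ≤ 1 / (Fintype.card α : ℝ) :=
    mul_le_of_le_one_left hd1 (by linarith)
  rcases o with _ | ⟨q, _ | ⟨a, v⟩⟩
  · exact ⟨hd1, hd2⟩
  · exact ⟨hd1, hd2⟩
  · have hn : (0 : ℝ) ≤ (G.β q a b : ℝ) := by exact_mod_cast G.β_nonneg q a b
    refine ⟨hn, ?_⟩
    have e : (G.mix hα t h0 h1).betAt (some (q, a :: v)) b =
      (((1 - t) * G.β q a b + t / (Fintype.card α : ℚ) : ℚ) : ℝ) := rfl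
    have e' : G.betAt (some (q, a :: v)) b = (G.β q a b : ℝ) := rfl
    rw [e']
    refine le_trans ?_ (le_of_eq e.symm)
    push_cast
    have h3 : (0 : ℝ) ≤ (t : ℝ) / (Fintype.card α : ℝ) := by positivity
    have h4 := mul_le_mul_of_nonneg_right hr hn
    linarith

theorem BPDG.mix_martFrom {α : Type} [Fintype α] (hα : 2 ≤ Fintype.card α) (G : BPDG α)
    (t : ℚ) (h0 : 0 < t) (h1 : t < 1) (r : ℝ) (hr0 : 0 ≤ r) (hr : r ≤ 1 - (t : ℝ))
    (w : List α) : ∀ o : Option (G.Q × List G.Γ),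
      0 ≤ G.martFrom o w ∧
      r ^ w.length * G.martFrom o w ≤ (G.mix hα t h0 h1).martFrom o w := by
  have ht : (0 : ℝ) < t := by exact_mod_cast h0
  induction w with
  | nil => intro o; simp [BPDG.martFrom]
  | cons b w ih =>
    intro o
    obtain ⟨ih1, ih2⟩ := ih (o.bind (symStep G.δ G.c b))
    have hb := BPDG.mix_betAt hα G t h0 h1 r hr b o
    obtain ⟨hb1, hb2⟩ := hb
    have hstep : (G.mix hα t h0 h1).martFrom o (b :: w) =
        (Fintype.card α : ℝ) * (G.mix hα t h0 h1).betAt o b *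
          (G.mix hα t h0 h1).martFrom (o.bind (symStep G.δ G.c b)) w := rfl
    have hstep' : G.martFrom o (b :: w) =
        (Fintype.card α : ℝ) * G.betAt o b *
          G.martFrom (o.bind (symStep G.δ G.c b)) w := rfl
    rw [hstep, hstep']
    refine ⟨by positivity, ?_⟩
    calc _ = ((Fintype.card α : ℝ) * (r * G.betAt o b)) *
          (r ^ w.length * G.martFrom (o.bind (symStep G.δ G.c b)) w) := by
            rw [List.length_cons]; ring
      _ ≤ _ := by
        apply mul_le_mul _ ih2 (by positivity)
        · exact mul_nonneg (by positivity) (le_trans (by positivity) hb2)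
        · exact mul_le_mul_of_nonneg_left hb2 (by positivity)

/-- For every bounded pushdown gambler `G` and every `ε > 0`
there is a nonvanishing bounded pushdown gambler `G'` such that for all
`w ∈ Σ*`, `d_{G'}(w) ≥ |Σ|^{-ε|w|} d_G(w)`. -/
theorem bpdg_nonvanishing {α : Type} [Fintype α] (hα : 2 ≤ Fintype.card α)
    (G : BPDG α) (ε : ℝ) (hε : 0 < ε) :
    ∃ G' : BPDG α, G'.nonvanishing ∧
      ∀ w : List α,
        (Fintype.card α : ℝ) ^ (-ε * (w.length : ℝ)) * G.mart w ≤ G'.mart w := by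
  have hk : (1 : ℝ) < (Fintype.card α : ℝ) := by
    have : 1 < Fintype.card α := by omega
    exact_mod_cast this
  have hkq : (1 : ℚ) < (Fintype.card α : ℚ) := by
    have : 1 < Fintype.card α := by omega
    exact_mod_cast this
  have hr1 : (Fintype.card α : ℝ) ^ (-ε) < 1 := Real.rpow_lt_one_of_one_lt_of_neg hk (by linarith)
  have hr0 : 0 < (Fintype.card α : ℝ) ^ (-ε) := Real.rpow_pos_of_pos (by linarith) _
  obtain ⟨t, ht0, ht1⟩ := exists_rat_btwn (sub_pos.mpr hr1)
  have h0 : 0 < t := by exact_mod_cast ht0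
  have h1 : t < 1 := by
    have : (t : ℝ) < 1 := by linarith
    exact_mod_cast this
  refine ⟨G.mix hα t h0 h1, ?_, ?_⟩
  · intro q z b
    change 0 < (1 - t) * G.β q z b + t / (Fintype.card α : ℚ) ∧
      (1 - t) * G.β q z b + t / (Fintype.card α : ℚ) < 1
    have hn := G.β_nonneg q z b
    have hle : G.β q z b ≤ 1 := by
      rw [← G.β_sum q z]
      exact Finset.single_le_sum (fun i _ => G.β_nonneg q z i) (Finset.mem_univ b)
    have h2 : 0 < 1 - t := by linarith
    have h3 : t / (Fintype.card α : ℚ) < t := div_lt_self h0 hkq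
    have h4 : 0 < t / (Fintype.card α : ℚ) := div_pos h0 (by linarith)
    exact ⟨by positivity, by nlinarith⟩
  · intro w
    rw [Real.rpow_mul_natCast (by linarith)]
    exact (BPDG.mix_martFrom hα G t h0 h1 _ hr0.le (by linarith) w _).2
end
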